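/- arXiv:1506.06146 — 7 statements merged into one kernel-verified Lean document; each statement's English description precedes it below -/
import Mathlib

section
/- Let B → A be a local homomorphism from a complete Noetherian local ring B to an Artinian local ring A. Then this morphism admits a factorisation B → B' → A, where B → B' is a faithfully flat local morphism of complete Noetherian local rings and B' → A is surjective (so in particular induces an isomorphism on residue fields). -/
universe u

namespace Fac

section
open MvPolynomial in
lemma monic_cancel {R : Type*} [CommRing R] (I : Ideal R) (g h : Polynomial R) (hg : g.Monic)
    (H : h * g ∈ I.map Polynomial.C) : h ∈ I.map Polynomial.C := by
  have key : I.map Polynomial.C = RingHom.ker (Polynomial.mapRingHom (Ideal.Quotient.mk I)) := by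
    rw [Polynomial.ker_mapRingHom, Ideal.mk_ker]
  rw [key, RingHom.mem_ker] at H ⊢
  rw [map_mul] at H
  have hm : (Polynomial.mapRingHom (Ideal.Quotient.mk I) g).Monic := hg.map _
  exact (hm.mul_left_eq_zero_iff).1 H

/-- existence of a monic lift of the minimal polynomial -/
lemma exists_minrel {k K Y : Type*} [Field k] [Field K] [Algebra k K] [Algebra.IsAlgebraic k K]
    (w : Y → K) (t : K) :
    ∃ p : Polynomial (MvPolynomial Y k), p.Monic ∧
      Polynomial.eval₂ (MvPolynomial.aeval (R := k) w).toRingHom t p = 0 ∧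
      ∀ r : Polynomial (MvPolynomial Y k), r.degree < p.degree →
        Polynomial.eval₂ (MvPolynomial.aeval (R := k) w).toRingHom t r = 0 →
        ∀ i, MvPolynomial.aeval w (r.coeff i) = 0 := by
  let E := IntermediateField.adjoin k (Set.range w)
  let e : MvPolynomial Y k →ₐ[k] E :=
    MvPolynomial.aeval (fun y => ⟨w y, IntermediateField.subset_adjoin _ _ ⟨y, rfl⟩⟩)
  have hcomp : (MvPolynomial.aeval (R := k) w).toRingHom = (algebraMap E K).comp e.toRingHom := by
    have : MvPolynomial.aeval (R := k) w = (IsScalarTower.toAlgHom k E K).comp e := by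
      ext y; simp [e]
    rw [this]; rfl
  have hs : Function.Surjective e.toRingHom := by
    rintro ⟨z, hz⟩
    have h2 : z ∈ (IntermediateField.adjoin k (Set.range w)).toSubalgebra := hz
    rw [IntermediateField.adjoin_toSubalgebra, Algebra.adjoin_range_eq_range_aeval] at h2
    obtain ⟨q, hq⟩ := h2
    refine ⟨q, Subtype.ext ?_⟩
    have := DFunLike.congr_fun hcomp q
    exact this.symm.trans hq
  have hInt : IsIntegral E t := Algebra.IsIntegral.isIntegral t
  have hl : minpoly E t ∈ Polynomial.lifts e.toRingHom := by
    rw [Polynomial.lifts_iff_coeff_lifts]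
    intro n; exact hs _
  obtain ⟨p, hp1, hp2, hp3⟩ := Polynomial.lifts_and_degree_eq_and_monic hl (minpoly.monic hInt)
  refine ⟨p, hp3, ?_, ?_⟩
  · rw [hcomp, ← Polynomial.eval₂_map, hp1]
    exact minpoly.aeval E t
  · intro r hr h0 i
    rw [hcomp, ← Polynomial.eval₂_map] at h0
    have hz : r.map e.toRingHom = 0 := by
      by_contra hne
      have := minpoly.degree_le_of_ne_zero E t hne h0
      rw [← hp2] at this
      exact absurd (this.trans Polynomial.degree_map_le) (not_le.2 hr)
    have h1 : e (r.coeff i) = 0 := by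
      have := congrArg (fun q => Polynomial.coeff q i) hz
      simpa using this
    refine (DFunLike.congr_fun hcomp (r.coeff i)).trans ?_
    change algebraMap E K (e (r.coeff i)) = 0
    rw [h1, map_zero]

open MvPolynomial in
lemma exists_rels {k K ι : Type*} [Field k] [Field K] [Algebra k K] [Algebra.IsAlgebraic k K]
    [LinearOrder ι] [WellFoundedLT ι] (v : ι → K) :
    ∃ g : ι → MvPolynomial ι k,
      (∀ x, ∀ F : Finset ι, (∀ y ∈ F, y < x) → ∀ h,
        h * g x ∈ Ideal.span (g '' F) → h ∈ Ideal.span (g '' F)) ∧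
      Ideal.span (Set.range g) = RingHom.ker (aeval (R := k) v) := by
  choose p hp1 hp2 hp3 using fun x : ι =>
    exists_minrel (k := k) (fun y : Set.Iio x => v y) (v x)
  -- the evaluation map
  let ψ : (x : ι) → Polynomial (MvPolynomial (Set.Iio x) k) →+* MvPolynomial ι k := fun x =>
    Polynomial.eval₂RingHom (rename (R := k) (Subtype.val : Set.Iio x → ι)).toRingHom (MvPolynomial.X x)
  let g : ι → MvPolynomial ι k := fun x => ψ x (p x)
  have hψ : ∀ x q, aeval v (ψ x q) = Polynomial.eval₂ (aeval (R := k) (fun y : Set.Iio x => v y)).toRingHom (v x) q := by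
    intro x q
    have : ((aeval (R := k) v).toRingHom.comp (ψ x)) =
        Polynomial.eval₂RingHom (aeval (R := k) (fun y : Set.Iio x => v y)).toRingHom (v x) := by
      apply Polynomial.ringHom_ext
      · intro a
        simp [ψ, aeval_rename, Function.comp_def]
      · simp [ψ]
    exact DFunLike.congr_fun this q
  refine ⟨g, ?_, ?_⟩
  · intro x F hF h hh
    let Φ : MvPolynomial ι k →+* Polynomial (MvPolynomial ι k) :=
      eval₂Hom (Polynomial.C.comp C) (fun y => if y = x then Polynomial.X else Polynomial.C (X y))
    let Ψ : Polynomial (MvPolynomial ι k) →+* MvPolynomial ι k :=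
      Polynomial.eval₂RingHom (RingHom.id _) (X x)
    have hΨΦ : Ψ.comp Φ = RingHom.id _ := by
      apply MvPolynomial.ringHom_ext
      · intro a; simp [Φ, Ψ]
      · intro y
        by_cases hy : y = x <;> simp [Φ, Ψ, hy]
    have hΦr : ∀ y ≤ x, ∀ q : MvPolynomial (Set.Iio y) k,
        Φ (rename Subtype.val q) = Polynomial.C (rename Subtype.val q) := by
      intro y hy q
      have : Φ.comp (rename (R := k) (Subtype.val : Set.Iio y → ι)).toRingHom =
          Polynomial.C.comp (rename (R := k) (Subtype.val : Set.Iio y → ι)).toRingHom := by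
        apply MvPolynomial.ringHom_ext
        · intro a; simp [Φ]
        · rintro ⟨z, hz⟩
          have : z ≠ x := (lt_of_lt_of_le hz hy).ne
          simp [Φ, this]
      exact DFunLike.congr_fun this q
    have hΦlt : ∀ y < x, Φ (g y) = Polynomial.C (g y) := by
      intro y hy
      have : Φ.comp (ψ y) = Polynomial.C.comp (ψ y) := by
        apply Polynomial.ringHom_ext
        · intro a
          simpa [ψ] using hΦr y hy.le a
        · simp [ψ, Φ, hy.ne]
      exact DFunLike.congr_fun this (p y)
    have hΦx : Φ (g x) = (p x).map (rename (R := k) (Subtype.val : Set.Iio x → ι)).toRingHom := by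
      have : Φ.comp (ψ x) = Polynomial.mapRingHom (rename (R := k) (Subtype.val : Set.Iio x → ι)).toRingHom := by
        apply Polynomial.ringHom_ext
        · intro a
          simpa [ψ] using hΦr x le_rfl a
        · simp [ψ, Φ]
      exact DFunLike.congr_fun this (p x)
    have hI : (Ideal.span (g '' F)).map Φ ≤ (Ideal.span (g '' F)).map Polynomial.C := by
      rw [Ideal.map_span, Ideal.span_le]
      rintro _ ⟨_, ⟨y, hy, rfl⟩, rfl⟩
      rw [hΦlt y (hF y hy)]
      exact Ideal.mem_map_of_mem _ (Ideal.subset_span ⟨y, hy, rfl⟩)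
    have h1 : Φ h * Φ (g x) ∈ (Ideal.span (g '' F)).map Polynomial.C := by
      rw [← map_mul]; exact hI (Ideal.mem_map_of_mem _ hh)
    have h2 := monic_cancel _ _ _ (by rw [hΦx]; exact (hp1 x).map _) h1
    have h3 : Ψ (Φ h) ∈ ((Ideal.span (g '' F)).map Polynomial.C).map Ψ := Ideal.mem_map_of_mem _ h2
    rw [Ideal.map_map, show Ψ.comp Polynomial.C = RingHom.id _ by ext <;> simp [Ψ], Ideal.map_id] at h3
    have h4 : Ψ (Φ h) = h := DFunLike.congr_fun hΨΦ h
    rwa [h4] at h3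
  · apply le_antisymm
    · rw [Ideal.span_le]
      rintro _ ⟨x, rfl⟩
      change aeval v (ψ x (p x)) = 0
      rw [hψ, hp2]
    · have fin : ∀ S : Set ι, (∀ x ∈ S, ∀ h ∈ supported k (Set.Iic x), aeval v h = 0 →
          h ∈ Ideal.span (Set.range g)) → ∀ h ∈ supported k S, aeval v h = 0 →
          h ∈ Ideal.span (Set.range g) := by
        intro S hS h hh h0
        by_cases hne : h.vars.Nonempty
        · have hm := h.vars.max'_mem hne
          refine hS (h.vars.max' hne) (mem_supported.1 hh hm) h ?_ h0
          rw [mem_supported]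
          intro y hy
          exact h.vars.le_max' y hy
        · rw [Finset.not_nonempty_iff_eq_empty] at hne
          obtain ⟨c, rfl⟩ : ∃ c, h = C c := ⟨_, (vars_eq_empty_iff_eq_C).1 hne⟩
          have : c = 0 := by simpa using h0
          simp [this]
      have main : ∀ x, ∀ h ∈ supported k (Set.Iic x), aeval v h = 0 →
          h ∈ Ideal.span (Set.range g) := by
        intro x
        induction x using WellFoundedLT.induction with
        | ind x ih =>
        intro h hh h0
        have ih' := fin (Set.Iio x) (fun y hy => ih y hy)
        obtain ⟨H, rfl⟩ : ∃ H, ψ x H = h := by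
          have : supported k (Set.Iic x) ≤ (AlgHom.mk (ψ x) (by intro r; simp [ψ, MvPolynomial.algebraMap_eq]) : _ →ₐ[k] _).range := by
            rw [supported_eq_adjoin_X, Algebra.adjoin_le_iff]
            rintro _ ⟨y, hy, rfl⟩
            rcases (Set.mem_Iic.1 hy).lt_or_eq with h | h
            · exact ⟨Polynomial.C (X ⟨y, h⟩), by simp [ψ]⟩
            · exact ⟨Polynomial.X, by simp [ψ, h]⟩
          exact this hh
        have hd := Polynomial.modByMonic_add_div H (p x)
        rw [← hd, map_add, map_mul]
        refine Ideal.add_mem _ ?_ (Ideal.mul_mem_right _ _ (Ideal.subset_span ⟨x, rfl⟩))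
        rw [hψ, ← hd, Polynomial.eval₂_add, Polynomial.eval₂_mul, hp2, zero_mul, add_zero] at h0
        have hc := hp3 x _ (Polynomial.degree_modByMonic_lt _ (hp1 x)) h0
        have : ψ x (H %ₘ p x) = (H %ₘ p x).sum (fun i a => rename Subtype.val a * X x ^ i) := by
          simp [ψ, Polynomial.eval₂_eq_sum]
        rw [this, Polynomial.sum_def]
        refine Ideal.sum_mem _ fun i _ => Ideal.mul_mem_right _ _ (ih' _ ?_ ?_)
        · rw [mem_supported]
          intro y hy
          classical
          have := vars_rename _ _ hy
          simp only [Finset.mem_image] at this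
          obtain ⟨z, _, rfl⟩ := this
          exact z.2
        · rw [aeval_rename]; exact hc i
      intro h h0
      exact fin Set.univ (fun x _ => main x) h (by simp) h0
end


section
lemma inf_le_mul {P ι : Type*} [CommRing P] [LinearOrder ι] (M : Ideal P) (G : ι → P)
    (reg : ∀ x, ∀ F : Finset ι, (∀ y ∈ F, y < x) → ∀ h,
        h * G x ∈ Ideal.span (G '' F) ⊔ M → h ∈ Ideal.span (G '' F) ⊔ M) :
    Ideal.span (Set.range G) ⊓ M ≤ M * Ideal.span (Set.range G) := by
  classical
  have key : ∀ F : Finset ι, Ideal.span (G '' F) ⊓ M ≤ M * Ideal.span (Set.range G) := by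
    intro F
    induction F using Finset.induction_on_max with
    | empty => simp
    | insert a s hs ih =>
      rintro z ⟨hz, hzM⟩
      rw [Finset.coe_insert, Set.image_insert_eq] at hz
      obtain ⟨c, w, hw, rfl⟩ := Ideal.mem_span_insert.1 hz
      have hc : c ∈ Ideal.span (G '' s) ⊔ M := by
        refine reg a s hs c ?_
        have : c * G a = -w + (c * G a + w) := by ring
        rw [this]
        exact Submodule.add_mem_sup (neg_mem hw) hzM
      obtain ⟨t, ht, μ, hμ, rfl⟩ := Submodule.mem_sup.1 hc
      have e : (t + μ) * G a + w = μ * G a + (w + t * G a) := by ring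
      have hμG : μ * G a ∈ M * Ideal.span (Set.range G) :=
        Ideal.mul_mem_mul hμ (Ideal.subset_span ⟨a, rfl⟩)
      rw [e]
      refine add_mem hμG (ih ⟨add_mem hw (Ideal.mul_mem_right _ _ ht), ?_⟩)
      have : w + t * G a = ((t + μ) * G a + w) - μ * G a := by ring
      rw [this]
      exact sub_mem hzM (Ideal.mul_mem_right _ _ hμ)
  rintro z ⟨hz, hzM⟩
  obtain ⟨T, hT, hzT⟩ := Submodule.mem_span_finite_of_mem_span hz
  rw [← Set.image_univ] at hT
  obtain ⟨F, -, rfl⟩ := Finset.subset_set_image_iff.1 hT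
  refine key F ⟨?_, hzM⟩
  simpa using hzT

lemma basis_lift {S P F : Type*} [CommRing S] [AddCommGroup P] [Module S P] [Module.Projective S P]
    [AddCommGroup F] [Module S F] (m : Ideal S) (J : Submodule S P) (φ : F →ₗ[S] P)
    (h1 : J ⊓ m • ⊤ ≤ m • J) (h2 : LinearMap.range φ ⊔ J ⊔ m • ⊤ = ⊤)
    (h3 : ∀ z, φ z ∈ J ⊔ m • ⊤ → z ∈ m • (⊤ : Submodule S F)) (n : ℕ) :
    (LinearMap.range φ ⊔ J ⊔ m ^ n • ⊤ = ⊤) ∧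
      ∀ z, φ z ∈ J ⊔ m ^ n • ⊤ → z ∈ m ^ n • (⊤ : Submodule S F) := by
  have hs : ∀ n, LinearMap.range φ ⊔ J ⊔ m ^ n • ⊤ = ⊤ := by
    intro n
    induction n with
    | zero => simp
    | succ n ih =>
      rw [eq_top_iff]
      conv_lhs => rw [← ih]
      refine sup_le le_sup_left ?_
      conv_lhs => rw [← h2]
      rw [Submodule.smul_sup, ← Submodule.mul_smul, ← pow_succ]
      exact sup_le_sup_right Submodule.smul_le_right _
  refine ⟨hs n, ?_⟩
  rcases Nat.eq_zero_or_pos n with rfl | hn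
  · simp
  set N := J ⊔ m ^ n • (⊤ : Submodule S P) with hN
  have hNle : N ≤ J ⊔ m • ⊤ := by
    refine sup_le_sup_left (Submodule.smul_mono_left (Ideal.pow_le_self hn.ne')) _
  have hsurj : Function.Surjective (N.mkQ ∘ₗ φ) := by
    rw [← LinearMap.range_eq_top, LinearMap.range_comp, eq_top_iff, ← Submodule.range_mkQ N,
      LinearMap.range_eq_map, ← hs n, sup_assoc, Submodule.map_sup]
    refine sup_le le_rfl ?_
    rintro _ ⟨y, hy, rfl⟩
    rw [Submodule.mkQ_apply, (Submodule.Quotient.mk_eq_zero N).2 hy]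
    exact zero_mem _
  obtain ⟨θ, hθ⟩ := Module.projective_lifting_property (N.mkQ ∘ₗ φ) N.mkQ hsurj
  have hθ' : ∀ p, φ (θ p) - p ∈ N := by
    intro p
    rw [← Submodule.Quotient.eq]
    exact LinearMap.congr_fun hθ p
  let Z := N.comap φ
  have hZ : Z ≤ m • Z ⊔ m ^ n • ⊤ := by
    intro z hz
    have hzm : z ∈ m • (⊤ : Submodule S F) := h3 z (hNle hz)
    have a1 : z - θ (φ z) ∈ m • Z := by
      have : Submodule.map (LinearMap.id - θ ∘ₗ φ) (m • ⊤) ≤ m • Z := by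
        rw [Submodule.map_smul'']
        refine Submodule.smul_mono le_rfl ?_
        rintro _ ⟨y, -, rfl⟩
        change φ (y - θ (φ y)) ∈ N
        rw [map_sub, ← neg_sub]
        exact neg_mem (hθ' _)
      exact this ⟨z, hzm, rfl⟩
    have hφz : φ z ∈ N := hz
    obtain ⟨j, hj, p, hp, hjp⟩ := Submodule.mem_sup.1 hφz
    have hpm : p ∈ m • (⊤ : Submodule S P) := Submodule.smul_mono_left (Ideal.pow_le_self hn.ne') hp
    have hφm : φ z ∈ m • (⊤ : Submodule S P) := by
      have : Submodule.map φ (m • ⊤) ≤ m • ⊤ := by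
        rw [Submodule.map_smul'']; exact Submodule.smul_mono le_rfl le_top
      exact this ⟨z, hzm, rfl⟩
    have hjm : j ∈ m • J := by
      refine h1 ⟨hj, ?_⟩
      rw [eq_sub_of_add_eq hjp]
      exact sub_mem hφm hpm
    have a2 : θ j ∈ m • Z := by
      have : Submodule.map θ (m • J) ≤ m • Z := by
        rw [Submodule.map_smul'']
        refine Submodule.smul_mono le_rfl ?_
        rintro _ ⟨y, hy, rfl⟩
        change φ (θ y) ∈ N
        rw [← sub_add_cancel (φ (θ y)) y]
        exact add_mem (hθ' _) (Submodule.mem_sup_left hy)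
      exact this ⟨j, hjm, rfl⟩
    have a3 : θ p ∈ m ^ n • (⊤ : Submodule S F) := by
      have : Submodule.map θ (m ^ n • ⊤) ≤ m ^ n • ⊤ := by
        rw [Submodule.map_smul'']
        exact Submodule.smul_mono le_rfl le_top
      exact this ⟨p, hp, rfl⟩
    have : z = ((z - θ (φ z)) + θ j) + θ p := by
      rw [← hjp, map_add]; abel
    rw [this]
    exact Submodule.add_mem_sup (add_mem a1 a2) a3
  have hZj : ∀ j, Z ≤ m ^ j • Z ⊔ m ^ n • ⊤ := by
    intro j
    induction j with
    | zero => simp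
    | succ j ih =>
      refine ih.trans (sup_le ?_ le_sup_right)
      refine (Submodule.smul_mono le_rfl hZ).trans ?_
      rw [Submodule.smul_sup, ← Submodule.mul_smul, ← pow_succ]
      exact sup_le_sup_left Submodule.smul_le_right _
  intro z hz
  exact (sup_le (Submodule.smul_mono le_rfl le_top) le_rfl : m ^ n • Z ⊔ m ^ n • ⊤ ≤ m ^ n • ⊤) (hZj n hz)
end


section
section
attribute [local instance] MvPolynomial.gradedAlgebra
lemma homComp_mul {σ R : Type*} [CommRing R] (n d : ℕ) (h F : MvPolynomial σ R)
    (hF : F.IsHomogeneous d) : MvPolynomial.homogeneousComponent n (h * F) =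
      if d ≤ n then MvPolynomial.homogeneousComponent (n - d) h * F else 0 := by
  have := DirectSum.coe_decompose_mul_of_right_mem (MvPolynomial.homogeneousSubmodule σ R)
    (a := h) n hF
  rw [← MvPolynomial.decomposition.decompose'_apply, ← MvPolynomial.decomposition.decompose'_apply]
  exact this
end

lemma map_homComp {σ R T : Type*} [CommRing R] [CommRing T] (f : R →+* T) (n : ℕ)
    (h : MvPolynomial σ R) : MvPolynomial.map f (MvPolynomial.homogeneousComponent n h) =
      MvPolynomial.homogeneousComponent n (MvPolynomial.map f h) := by
  ext d
  simp only [MvPolynomial.coeff_map, MvPolynomial.coeff_homogeneousComponent]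
  split_ifs <;> simp

lemma eval_mem_pow {σ R : Type*} [CommRing R] (x : σ → R) (n : ℕ) (F : MvPolynomial σ R)
    (hF : F.IsHomogeneous n) : MvPolynomial.eval x F ∈ Ideal.span (Set.range x) ^ n :=
  (Ideal.mem_span_pow_iff_exists_isHomogeneous x _).2 ⟨F, hF, rfl⟩

lemma eval_mem_pow_succ {σ R : Type*} [CommRing R] (x : σ → R) (n : ℕ) (F : MvPolynomial σ R)
    (hF : F.IsHomogeneous n)
    (h0 : MvPolynomial.map (Ideal.Quotient.mk (Ideal.span (Set.range x))) F = 0) :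
    MvPolynomial.eval x F ∈ Ideal.span (Set.range x) ^ (n + 1) := by
  rw [F.as_sum, map_sum]
  refine sum_mem fun d hd => ?_
  rw [show MvPolynomial.monomial d (F.coeff d) = MvPolynomial.C (F.coeff d) * MvPolynomial.monomial d 1 by
    simp [MvPolynomial.C_mul_monomial], map_mul, pow_succ']
  refine Ideal.mul_mem_mul ?_ (eval_mem_pow x n _ ?_)
  · have := congrArg (MvPolynomial.coeff d) h0
    rw [MvPolynomial.coeff_map, MvPolynomial.coeff_zero, Ideal.Quotient.eq_zero_iff_mem] at this
    simpa using this
  · apply MvPolynomial.isHomogeneous_monomial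
    have := hF (MvPolynomial.mem_support_iff.1 hd)
    rw [Finsupp.degree_eq_weight_one]
    exact this

lemma complete_le_span {R J : Type*} [CommRing R] [Fintype J] (M I : Ideal R) [IsAdicComplete M R]
    (a : J → R) (D : ℕ) (ha : ∀ j, a j ∈ I)
    (step : ∀ n, ∀ y ∈ I ⊓ M ^ n, ∃ c : J → R, (∀ j, c j ∈ M ^ (n - D)) ∧
      y - ∑ j, c j * a j ∈ M ^ (n + 1)) : I ≤ Ideal.span (Set.range a) := by
  intro y hy
  choose! c hc1 hc2 using step
  let e : ℕ → R := fun n => Nat.rec y (fun n z => z - ∑ j, c n z j * a j) n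
  have e0 : e 0 = y := rfl
  have es : ∀ n, e (n + 1) = e n - ∑ j, c n (e n) j * a j := fun n => rfl
  have he : ∀ n, e n ∈ I ⊓ M ^ n := by
    intro n
    induction n with
    | zero => simpa [e0] using hy
    | succ n ih =>
      refine ⟨?_, ?_⟩
      · rw [es]
        exact sub_mem ih.1 (sum_mem fun j _ => Ideal.mul_mem_left _ _ (ha j))
      · rw [es]; exact hc2 n _ ih
  let s : J → ℕ → R := fun j N => ∑ n ∈ Finset.range N, c n (e n) j
  have hs : ∀ N, y = e N + ∑ j, s j N * a j := by
    intro N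
    induction N with
    | zero => simp [s, e0]
    | succ N ih =>
      rw [es]
      simp only [s, Finset.sum_range_succ, add_mul, Finset.sum_add_distrib] at ih ⊢
      linear_combination ih
  have hL : ∀ j, ∃ L, ∀ n, s j (n + D) ≡ L [SMOD (M ^ n • ⊤ : Submodule R R)] := by
    intro j
    apply IsPrecomplete.prec' (I := M) (fun n => s j (n + D))
    intro m n hmn
    obtain ⟨k, rfl⟩ := Nat.exists_eq_add_of_le hmn
    rw [SModEq.comm, SModEq.sub_mem, smul_eq_mul, Ideal.mul_top]
    have : s j (m + k + D) - s j (m + D) = ∑ i ∈ Finset.range k, c (m + D + i) (e (m + D + i)) j := by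
      simp only [s]
      rw [show m + k + D = m + D + k by ring, Finset.sum_range_add]
      ring
    rw [this]
    exact sum_mem fun i _ => Ideal.pow_le_pow_right (by omega) (hc1 _ _ (he _) j)
  choose L hL using hL
  have : y - ∑ j, L j * a j = 0 := by
    apply IsHausdorff.haus' (I := M)
    intro n
    rw [SModEq.zero, smul_eq_mul, Ideal.mul_top]
    have h2 : y - ∑ j, L j * a j = e (n + D) + ∑ j, (s j (n + D) - L j) * a j := by
      nth_rw 1 [hs (n + D)]
      simp only [sub_mul, Finset.sum_sub_distrib]
      ring
    rw [h2]
    refine add_mem (Ideal.pow_le_pow_right (by omega) (he _).2) (sum_mem fun j _ => Ideal.mul_mem_right _ _ ?_)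
    have := hL j n
    rwa [SModEq.sub_mem, smul_eq_mul, Ideal.mul_top] at this
  rw [sub_eq_zero.1 this]
  exact sum_mem fun j _ => Ideal.mul_mem_left _ _ (Ideal.subset_span ⟨j, rfl⟩)

lemma noeth {R : Type*} [CommRing R] (M : Ideal R) [M.IsMaximal] (hM : M.FG) [IsAdicComplete M R] :
    IsNoetherianRing R := by
  classical
  obtain ⟨r, x, hx⟩ := Submodule.fg_iff_exists_fin_generating_family.1 hM
  replace hx : Ideal.span (Set.range x) = M := hx
  subst hx
  refine (isNoetherianRing_iff_ideal_fg R).2 fun I => ?_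
  set M := Ideal.span (Set.range x) with hMdef
  letI : Field (R ⧸ M) := Ideal.Quotient.field M
  let mp : MvPolynomial (Fin r) R →+* MvPolynomial (Fin r) (R ⧸ M) := MvPolynomial.map (Ideal.Quotient.mk M)
  let G : Set (MvPolynomial (Fin r) (R ⧸ M)) := {p | ∃ n F a, MvPolynomial.IsHomogeneous F n ∧
    a ∈ I ∧ a - MvPolynomial.eval x F ∈ M ^ (n + 1) ∧ mp F = p}
  obtain ⟨s, hsG, hs⟩ := (Submodule.fg_span_iff_fg_span_finset_subset G).1
    (IsNoetherian.noetherian (Ideal.span G))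
  choose! d F a hF haI haF hmp using (fun p (hp : p ∈ s) => hsG hp : ∀ p ∈ s, p ∈ G)
  suffices I = Ideal.span (Set.range (fun p : s => a p)) by
    rw [this]; exact Submodule.fg_span (Set.finite_range _)
  apply le_antisymm
  swap
  · rw [Ideal.span_le]; rintro _ ⟨p, rfl⟩; exact haI _ p.2
  refine complete_le_span M I _ (s.sup d) (fun j => haI _ j.2) ?_
  rintro n y ⟨hyI, hyn⟩
  obtain ⟨Y, hY, rfl⟩ := (Ideal.mem_span_pow_iff_exists_isHomogeneous x _).1 hyn
  have hYG : mp Y ∈ Submodule.span (MvPolynomial (Fin r) (R ⧸ M)) (s : Set (MvPolynomial (Fin r) (R ⧸ M))) := by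
    rw [← hs]
    exact Submodule.subset_span ⟨n, Y, _, hY, hyI, by simp, rfl⟩
  rw [Submodule.mem_span_finset] at hYG
  obtain ⟨h, -, hh⟩ := hYG
  have hsurj : Function.Surjective mp := MvPolynomial.map_surjective _ Ideal.Quotient.mk_surjective
  choose H hH using fun p => hsurj (h p)
  let H' : MvPolynomial (Fin r) (R ⧸ M) → MvPolynomial (Fin r) R := fun p =>
    if d p ≤ n then MvPolynomial.homogeneousComponent (n - d p) (H p) else 0
  have hH' : ∀ p ∈ s, mp (H' p * F p) = MvPolynomial.homogeneousComponent n (h p * p) := by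
    intro p hp
    have hpF : p.IsHomogeneous (d p) := by
      have := (hF p hp).map (Ideal.Quotient.mk M)
      rwa [show MvPolynomial.map (Ideal.Quotient.mk M) (F p) = p from hmp p hp] at this
    rw [homComp_mul n (d p) _ _ hpF, map_mul, hmp p hp]
    simp only [H']
    split_ifs
    · rw [← hH p]; simp only [mp]; rw [map_homComp]
    · simp
  have hhom : ∀ p ∈ s, (H' p * F p).IsHomogeneous n := by
    intro p hp
    simp only [H']
    split_ifs with hd
    · have := (MvPolynomial.homogeneousComponent_isHomogeneous (n - d p) (H p)).mul (hF p hp)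
      rwa [Nat.sub_add_cancel hd] at this
    · rw [zero_mul]; exact MvPolynomial.isHomogeneous_zero _ _ _
  refine ⟨fun p => MvPolynomial.eval x (H' p), ?_, ?_⟩
  · rintro ⟨p, hp⟩
    simp only [H']
    split_ifs with hd
    · refine Ideal.pow_le_pow_right ?_ (eval_mem_pow x _ _ (MvPolynomial.homogeneousComponent_isHomogeneous (n - d p) (H p)))
      have := Finset.le_sup (f := d) hp
      omega
    · simp
  · rw [Finset.sum_coe_sort s (fun p => MvPolynomial.eval x (H' p) * a p)]
    have e : MvPolynomial.eval x Y - ∑ p ∈ s, MvPolynomial.eval x (H' p) * a p =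
        MvPolynomial.eval x (Y - ∑ p ∈ s, H' p * F p) -
          ∑ p ∈ s, MvPolynomial.eval x (H' p) * (a p - MvPolynomial.eval x (F p)) := by
      simp only [map_sub, map_sum, map_mul, mul_sub, Finset.sum_sub_distrib]
      ring
    rw [e]
    refine sub_mem (eval_mem_pow_succ x n _ (hY.sub (MvPolynomial.IsHomogeneous.sum _ _ _ hhom)) ?_) (sum_mem fun p hp => ?_)
    · change mp _ = 0
      rw [map_sub, map_sum, Finset.sum_congr rfl hH', ← map_sum]
      have : ∑ p ∈ s, h p * p = mp Y := by simpa using hh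
      rw [this, MvPolynomial.homogeneousComponent_eq_self (hY.map _), sub_self]
    · simp only [H']
      split_ifs with hd
      · have := Ideal.mul_mem_mul (eval_mem_pow x _ _ (MvPolynomial.homogeneousComponent_isHomogeneous (n - d p) (H p))) (haF p hp)
        rw [← pow_add] at this
        rwa [show n - d p + (d p + 1) = n + 1 by omega] at this
      · simp
end


section
open TensorProduct


lemma map_smul_top {S M N : Type*} [CommRing S] [AddCommGroup M] [Module S M] [AddCommGroup N] [Module S N]
    (f : M →ₗ[S] N) (I : Ideal S) {x : M} (hx : x ∈ I • (⊤ : Submodule S M)) :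
    f x ∈ I • (⊤ : Submodule S N) := by
  have := Submodule.mem_map_of_mem (f := f) hx
  rw [Submodule.map_smul''] at this
  exact Submodule.smul_mono le_rfl le_top this

lemma flat_step {S F : Type*} [CommRing S] [AddCommGroup F] [Module S F] [Module.Flat S F]
    (I Q : Ideal S) (ζ : F ⊗[S] I)
    (h : TensorProduct.rid S F (I.subtype.lTensor F ζ) ∈ Q • (⊤ : Submodule S F)) :
    ζ ∈ LinearMap.range ((Submodule.comap I.subtype Q).subtype.lTensor F) := by
  have ex : Function.Exact (Submodule.comap I.subtype Q).subtype ((Submodule.mkQ Q).comp I.subtype) := by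
    intro y
    simp [Ideal.Quotient.eq_zero_iff_mem]
  have ex2 := Module.Flat.lTensor_exact F ex
  refine (ex2 ζ).1 ?_
  rw [LinearMap.lTensor_comp, LinearMap.comp_apply]
  set w := I.subtype.lTensor F ζ
  have hw : w = (TensorProduct.rid S F w) ⊗ₜ[S] (1 : S) := by
    rw [← TensorProduct.rid_symm_apply, LinearEquiv.symm_apply_apply]
  rw [hw]
  have key : Q • (⊤ : Submodule S F) ≤ LinearMap.ker ((Submodule.mkQ Q).lTensor F ∘ₗ (TensorProduct.rid S F).symm.toLinearMap) := by
    rw [Submodule.smul_le]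
    intro a ha z _
    rw [LinearMap.mem_ker]
    simp only [LinearMap.comp_apply, LinearEquiv.coe_coe, TensorProduct.rid_symm_apply, LinearMap.lTensor_tmul]
    rw [TensorProduct.smul_tmul, ← map_smul, show Submodule.mkQ Q (a • (1 : S)) = 0 from
      (Submodule.Quotient.mk_eq_zero Q (x := a • (1:S))).2 (by simpa using ha)]
    simp
  exact key h

lemma flat_of_approx {S B F : Type*} [CommRing S] [IsNoetherianRing S] [AddCommGroup F] [Module S F]
    [Module.Flat S F] [CommRing B] [IsNoetherianRing B] [IsLocalRing B] [Algebra S B]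
    (m : Ideal S) (hm : m.map (algebraMap S B) ≤ IsLocalRing.maximalIdeal B)
    (φ : F →ₗ[S] B) (h1 : ∀ n, ∀ x, ∃ z, x - φ z ∈ m ^ n • (⊤ : Submodule S B))
    (h2 : ∀ n, ∀ z, φ z ∈ m ^ n • (⊤ : Submodule S B) → z ∈ m ^ n • (⊤ : Submodule S F)) :
    Module.Flat S B := by
  rw [Module.Flat.iff_lTensor_injective']
  intro I
  rw [injective_iff_map_eq_zero]
  intro ξ hξ
  have key : ∀ k, ξ ∈ m ^ k • (⊤ : Submodule S (B ⊗[S] I)) := by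
    intro k
    obtain ⟨c, hc⟩ := Ideal.exists_pow_inf_eq_pow_smul m (I : Submodule S S)
    have AR : Submodule.comap I.subtype (m ^ (k + c)) ≤ m ^ k • (⊤ : Submodule S I) := by
      intro y hy
      rw [Submodule.mem_smul_top_iff]
      have h := hc (k + c) (by omega)
      have hy' : (y : S) ∈ m ^ (k + c) • (⊤ : Submodule S S) ⊓ I := ⟨by simpa using hy, y.2⟩
      rw [h, Nat.add_sub_cancel] at hy'
      exact Submodule.smul_mono le_rfl inf_le_right hy'
    have ex : ∀ ξ : B ⊗[S] I, ∃ ζ : F ⊗[S] I, ξ - φ.rTensor I ζ ∈ m ^ (k + c) • (⊤ : Submodule S (B ⊗[S] I)) := by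
      intro ξ
      induction ξ with
      | zero => exact ⟨0, by simp⟩
      | tmul x i =>
        obtain ⟨z, hz⟩ := h1 (k + c) x
        refine ⟨z ⊗ₜ i, ?_⟩
        have := map_smul_top ((TensorProduct.mk S B I).flip i) _ hz
        simpa [TensorProduct.sub_tmul] using this
      | add a b ha hb =>
        obtain ⟨z, hz⟩ := ha
        obtain ⟨w, hw⟩ := hb
        refine ⟨z + w, ?_⟩
        have := add_mem hz hw
        rw [map_add]
        convert this using 1
        abel
    obtain ⟨ζ, hζ⟩ := ex ξ
    have e1 : ∀ ζ : F ⊗[S] I, φ (TensorProduct.rid S F (I.subtype.lTensor F ζ)) =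
        TensorProduct.rid S B (I.subtype.lTensor B (φ.rTensor I ζ)) := by
      intro ζ
      induction ζ with
      | zero => simp
      | tmul x i => simp
      | add a b ha hb => simp only [map_add, ha, hb]
    have h3 : TensorProduct.rid S F (I.subtype.lTensor F ζ) ∈ m ^ (k + c) • (⊤ : Submodule S F) := by
      apply h2
      rw [e1]
      have := map_smul_top ((TensorProduct.rid S B).toLinearMap ∘ₗ I.subtype.lTensor B) _ hζ
      rw [map_sub] at this
      simp only [LinearMap.comp_apply, hξ] at this
      simpa using this
    obtain ⟨t, rfl⟩ := flat_step I _ ζ h3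
    have h4 : ∀ t, (Submodule.comap I.subtype (m ^ (k + c))).subtype.lTensor F t ∈ m ^ k • (⊤ : Submodule S (F ⊗[S] I)) := by
      intro t
      induction t with
      | zero => simp
      | tmul x i =>
        exact map_smul_top (TensorProduct.mk S F I x) _ (AR i.2)
      | add a b ha hb => rw [map_add]; exact add_mem ha hb
    have h5 := map_smul_top (φ.rTensor I) _ (h4 t)
    have h6 := Submodule.smul_mono (Ideal.pow_le_pow_right (by omega : k ≤ k + c)) le_rfl hζ
    have := add_mem h6 h5
    simpa using this
  have : Module.Finite B (B ⊗[S] I) := inferInstance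
  refine IsHausdorff.haus' (I := IsLocalRing.maximalIdeal B) ξ fun n => ?_
  rw [SModEq.zero]
  have h := key n
  have : (m ^ n • (⊤ : Submodule S (B ⊗[S] I))) ≤ (IsLocalRing.maximalIdeal B ^ n • (⊤ : Submodule B (B ⊗[S] I))).restrictScalars S := by
    rw [Submodule.smul_le]
    intro a ha y _
    rw [Submodule.restrictScalars_mem, ← algebraMap_smul B a y]
    refine Submodule.smul_mem_smul ?_ trivial
    refine Ideal.pow_right_mono hm n ?_
    rw [← Ideal.map_pow]
    exact Ideal.mem_map_of_mem _ ha
  exact this h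
end


section
open IsLocalRing

lemma top_of_nilp {S A : Type*} [CommRing S] [AddCommGroup A] [Module S A] (m : Ideal S)
    (T : Submodule S A) (h : T ⊔ m • ⊤ = ⊤) (n : ℕ) : T ⊔ m ^ n • ⊤ = ⊤ := by
  induction n with
  | zero => simp
  | succ n ih =>
    have h3 : m ^ n • (⊤ : Submodule S A) ≤ T ⊔ m ^ (n + 1) • ⊤ := by
      have e : m ^ n • (⊤ : Submodule S A) = m ^ n • (T ⊔ m • ⊤) := by rw [h]
      rw [e, Submodule.smul_sup, ← Submodule.mul_smul, ← pow_succ]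
      exact sup_le_sup_right Submodule.smul_le_right _
    exact top_unique (ih.ge.trans (sup_le le_sup_left h3))

lemma exists_C {S A : Type u} [CommRing S] [IsLocalRing S] [CommRing A] [IsLocalRing A]
    [Algebra S A] [IsLocalHom (algebraMap S A)]
    (hm : (maximalIdeal S).map (algebraMap S A) = maximalIdeal A)
    (hnil : ∃ N, maximalIdeal A ^ N = ⊥)
    [Algebra.IsAlgebraic (ResidueField S) (ResidueField A)] :
    ∃ (C : Type u) (_ : CommRing C) (_ : Algebra S C) (π : C →ₐ[S] A),
      Function.Surjective π ∧ ((maximalIdeal S).map (algebraMap S C)).IsMaximal ∧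
      ∃ (ι : Type u) (φ : (ι →₀ S) →ₗ[S] C), ∀ n,
        (∀ x, ∃ z, x - φ z ∈ maximalIdeal S ^ n • (⊤ : Submodule S C)) ∧
        (∀ z, φ z ∈ maximalIdeal S ^ n • (⊤ : Submodule S C) →
          z ∈ maximalIdeal S ^ n • (⊤ : Submodule S (ι →₀ S))) := by
  classical
  set K := ResidueField A with hK
  set k := ResidueField S with hk
  set m := maximalIdeal S with hmdef
  obtain ⟨σ, hσ⟩ : ∃ σ : K → A, ∀ x, residue A (σ x) = x :=
    ⟨_, Function.surjInv_eq (residue_surjective (R := A))⟩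
  let π : (MvPolynomial K S) →ₐ[S] A := MvPolynomial.aeval σ
  let ρ : (MvPolynomial K S) →+* MvPolynomial K k := MvPolynomial.map (residue S)
  let ev : MvPolynomial K k →ₐ[k] K := MvPolynomial.aeval id
  have hρ : Function.Surjective ρ := MvPolynomial.map_surjective _ residue_surjective
  have comm : ∀ p, ev (ρ p) = residue A (π p) := by
    intro p
    have : (ev : MvPolynomial K k →+* K).comp ρ = (residue A).comp (π : (MvPolynomial K S) →+* A) := by
      apply MvPolynomial.ringHom_ext
      · intro r; simp [ev, ρ, π]; exact ResidueField.algebraMap_residue r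
      · intro x; simp [ev, ρ, π, hσ]
    exact congrArg (fun f : (MvPolynomial K S) →+* K => f p) this
  have hπ : Function.Surjective π := by
    have h : LinearMap.range π.toLinearMap ⊔ m • ⊤ = ⊤ := by
      rw [eq_top_iff]
      intro a _
      have h1 : a - π (MvPolynomial.X (residue A a)) ∈ m • (⊤ : Submodule S A) := by
        rw [Ideal.smul_top_eq_map, hm, Submodule.restrictScalars_mem, ← residue_eq_zero_iff]
        simp [π, hσ]
      have := Submodule.add_mem_sup (LinearMap.mem_range_self π.toLinearMap (MvPolynomial.X (residue A a))) h1
      simpa using this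
    obtain ⟨N, hN⟩ := hnil
    have h2 := top_of_nilp m _ h N
    rw [Ideal.smul_top_eq_map, Ideal.map_pow, hm, hN] at h2
    intro a
    have : a ∈ LinearMap.range π.toLinearMap ⊔ Submodule.restrictScalars S (⊥ : Ideal A) := by rw [h2]; trivial
    rw [Submodule.restrictScalars_bot, sup_bot_eq] at this
    exact this
  let M : Ideal (MvPolynomial K S) := m.map (algebraMap S (MvPolynomial K S))
  have hM : RingHom.ker ρ = M := by
    simp only [ρ, M]
    rw [MvPolynomial.ker_map, ker_residue]
    rfl
  have hMA : M.map π = maximalIdeal A := by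
    rw [← hm]
    simp only [M]
    have := Ideal.map_map (I := m) (algebraMap S (MvPolynomial K S)) (π : (MvPolynomial K S) →+* A)
    rw [AlgHom.comp_algebraMap] at this
    exact this
  obtain ⟨_, _⟩ := exists_wellFoundedLT K
  obtain ⟨g, hg1, hg2⟩ := exists_rels (k := k) (K := K) (ι := K) id
  have hG : ∀ x, ∃ G : (MvPolynomial K S), π G = 0 ∧ ρ G = g x := by
    intro x
    obtain ⟨p, hp⟩ := hρ (g x)
    have h0 : ev (g x) = 0 := by
      have : g x ∈ RingHom.ker (MvPolynomial.aeval (R := k) (id : K → K)) := by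
        rw [← hg2]; exact Ideal.subset_span ⟨x, rfl⟩
      exact this
    rw [← hp, comm, residue_eq_zero_iff, ← hMA, Ideal.mem_map_iff_of_surjective _ hπ] at h0
    obtain ⟨q, hq, hqp⟩ := h0
    refine ⟨p - q, by simp [hqp], ?_⟩
    rw [← hM, RingHom.mem_ker] at hq
    rw [map_sub, hq, hp, sub_zero]
  choose G hGπ hGρ using hG
  have hsp : ∀ F : Set K, Ideal.span (G '' F) ⊔ M = Ideal.comap ρ (Ideal.span (g '' F)) := by
    intro F
    have := Ideal.comap_map_of_surjective' ρ hρ (Ideal.span (G '' F))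
    rw [hM] at this
    rw [← this, Ideal.map_span, ← Set.image_comp]
    congr 3
    funext x
    exact hGρ x
  let J : Ideal (MvPolynomial K S) := Ideal.span (Set.range G)
  have hJM : J ⊓ M ≤ M * J := by
    apply inf_le_mul
    intro x F hF h hh
    rw [hsp, Ideal.mem_comap] at hh ⊢
    rw [map_mul, hGρ] at hh
    exact hg1 x F hF _ hh
  have hJM2 : ∀ p, p ∈ J ⊔ M ↔ ev (ρ p) = 0 := by
    intro p
    have := hsp Set.univ
    rw [Set.image_univ, Set.image_univ, hg2] at this
    simp only [J]
    rw [this]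
    rfl
  have e1 : ∀ n, m ^ n • (⊤ : Submodule S (MvPolynomial K S)) = (M ^ n).restrictScalars S := by
    intro n
    rw [Ideal.smul_top_eq_map, Ideal.map_pow]
  have e1' : m • (⊤ : Submodule S (MvPolynomial K S)) = M.restrictScalars S := Ideal.smul_top_eq_map m
  let b := Module.Basis.ofVectorSpace k K
  let ι := Module.Basis.ofVectorSpaceIndex k K
  let φ : (ι →₀ S) →ₗ[S] (MvPolynomial K S) := Finsupp.linearCombination S (fun i => (MvPolynomial.X (b i) : (MvPolynomial K S)))
  have hφ : ∀ z, ev (ρ (φ z)) = Finsupp.linearCombination k b (z.mapRange (residue S) (map_zero _)) := by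
    intro z
    simp only [φ, Finsupp.linearCombination_apply]
    rw [Finsupp.sum_mapRange_index (by simp)]
    simp only [Finsupp.sum, map_sum]
    refine Finset.sum_congr rfl fun i _ => ?_
    rw [MvPolynomial.smul_eq_C_mul]
    simp [ρ, ev, Algebra.smul_def]
  have key := basis_lift m (J.restrictScalars S) φ ?_ ?_ ?_
  · refine ⟨(MvPolynomial K S) ⧸ J, inferInstance, inferInstance, Ideal.Quotient.liftₐ J π ?_, ?_, ?_, ι,
      (Ideal.Quotient.mkₐ S J).toLinearMap ∘ₗ φ, ?_⟩
    · intro a ha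
      have : J ≤ RingHom.ker π := by
        simp only [J]
        rw [Ideal.span_le]
        rintro _ ⟨x, rfl⟩
        exact hGπ x
      exact this ha
    · intro a
      obtain ⟨p, rfl⟩ := hπ a
      exact ⟨Ideal.Quotient.mk J p, rfl⟩
    · have hmax : (J ⊔ M).IsMaximal := by
        have h1 : J ⊔ M = RingHom.ker ((residue A).comp (π : (MvPolynomial K S) →+* A)) := by
          ext p
          rw [hJM2, comm]; rfl
        rw [h1]
        exact RingHom.ker_isMaximal_of_surjective _ (residue_surjective.comp hπ)
      have h2 := Ideal.IsMaximal.map_of_surjective_of_ker_le (f := Ideal.Quotient.mk J) Ideal.Quotient.mk_surjective (m := J ⊔ M)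
        (by rw [Ideal.mk_ker]; exact le_sup_left)
      rw [Ideal.map_sup, Ideal.map_quotient_self, bot_sup_eq] at h2
      simp only [M, Ideal.map_map] at h2
      exact h2
    · intro n
      obtain ⟨k1, k2⟩ := key n
      refine ⟨?_, ?_⟩
      · intro x
        obtain ⟨p, rfl⟩ := Ideal.Quotient.mk_surjective x
        have : p ∈ LinearMap.range φ ⊔ J.restrictScalars S ⊔ m ^ n • ⊤ := by rw [k1]; trivial
        obtain ⟨y, hy, w, hw, rfl⟩ := Submodule.mem_sup.1 this
        obtain ⟨_, ⟨z, rfl⟩, j, hj, rfl⟩ := Submodule.mem_sup.1 hy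
        refine ⟨z, ?_⟩
        have h3 := map_smul_top (Ideal.Quotient.mkₐ S J).toLinearMap _ hw
        have h4 : Ideal.Quotient.mk J j = 0 := Ideal.Quotient.eq_zero_iff_mem.2 hj
        simpa [h4] using h3
      · intro z hz
        apply k2
        have ht : (⊤ : Submodule S ((MvPolynomial K S) ⧸ J)) = Submodule.map (Ideal.Quotient.mkₐ S J).toLinearMap ⊤ := by
          rw [Submodule.map_top, eq_comm, LinearMap.range_eq_top]
          exact Ideal.Quotient.mk_surjective
        rw [ht, ← Submodule.map_smul''] at hz
        obtain ⟨w, hw, hwz⟩ := hz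
        have : φ z - w ∈ J := by
          rw [← Ideal.Quotient.eq]; exact hwz.symm
        have := Submodule.add_mem_sup (S := J.restrictScalars S) this hw
        simpa using this
  · rw [e1', ← Ideal.smul_restrictScalars]
    exact hJM
  · rw [eq_top_iff, e1']
    intro p _
    choose r hr using residue_surjective (R := S)
    set c := b.repr (ev (ρ p))
    let z : ι →₀ S := Finsupp.onFinset c.support (fun i => if c i = 0 then 0 else r (c i)) (by
      intro i hi
      simp only [ne_eq, ite_eq_left_iff, not_forall] at hi
      obtain ⟨hi, _⟩ := hi
      simpa using hi)
    have hz : z.mapRange (residue S) (map_zero _) = c := by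
      ext i
      simp only [Finsupp.mapRange_apply, z, Finsupp.onFinset_apply]
      split_ifs with h
      · simp [h]
      · exact hr _
    have h0 : p - φ z ∈ J ⊔ M := by
      rw [hJM2, map_sub, map_sub, hφ, hz, Module.Basis.linearCombination_repr, sub_self]
    obtain ⟨j, hj, w, hw, hjw⟩ := Submodule.mem_sup.1 h0
    rw [show p = φ z + j + w by rw [add_assoc, hjw]; ring]
    exact Submodule.add_mem_sup (Submodule.add_mem_sup ⟨z, rfl⟩ hj) hw
  · intro z hz
    rw [e1'] at hz
    have h0 : φ z ∈ J ⊔ M := by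
      obtain ⟨j, hj, w, hw, hjw⟩ := Submodule.mem_sup.1 hz
      rw [← hjw]
      exact Submodule.add_mem_sup hj hw
    rw [hJM2, hφ] at h0
    have h1 := linearIndependent_iff.1 b.linearIndependent _ h0
    rw [← Finsupp.sum_single z]
    refine sum_mem fun i _ => ?_
    rw [← mul_one (z i), ← smul_eq_mul, ← Finsupp.smul_single]
    refine Submodule.smul_mem_smul ?_ trivial
    have := DFunLike.congr_fun h1 i
    rw [hmdef, ← residue_eq_zero_iff]
    rw [Finsupp.mapRange_apply] at this
    exact this
end


section
open IsLocalRing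
lemma exists_B {S0 S A : Type u} [CommRing S0] [IsNoetherianRing S0] [IsLocalRing S0]
    [CommRing S] [IsLocalRing S] [CommRing A] [IsLocalRing A] [Algebra S0 S] [Module.Flat S0 S]
    [Algebra S A] [IsLocalHom (algebraMap S A)]
    (hm0 : (maximalIdeal S0).map (algebraMap S0 S) = maximalIdeal S)
    (hm : (maximalIdeal S).map (algebraMap S A) = maximalIdeal A)
    (hnil : ∃ N, maximalIdeal A ^ N = ⊥)
    [Algebra.IsAlgebraic (ResidueField S) (ResidueField A)] :
    ∃ (B : Type u) (_ : CommRing B) (_ : IsLocalRing B) (g : S0 →+* B) (h : B →+* A),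
      IsNoetherianRing B ∧ IsAdicComplete (maximalIdeal B) B ∧ g.Flat ∧ Function.Surjective h ∧
      h.comp g = (algebraMap S A).comp (algebraMap S0 S) := by
  obtain ⟨C, _, _, π, hπ, hmax, ι, φ, hφ⟩ := exists_C hm hnil
  set m := maximalIdeal S with hmdef
  set m0 := maximalIdeal S0 with hm0def
  set I : Ideal C := m.map (algebraMap S C) with hI
  let _ : Algebra S0 C := ((algebraMap S C).comp (algebraMap S0 S)).toAlgebra
  have : IsScalarTower S0 S C := IsScalarTower.of_algebraMap_eq' rfl
  have hI0 : I = m0.map (algebraMap S0 C) := by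
    rw [hI, ← hm0, Ideal.map_map]; rfl
  have hm0fg : m0.FG := IsNoetherian.noetherian m0
  have hIfg : I.FG := by rw [hI0]; exact hm0fg.map _
  let B := AdicCompletion I C
  have c1 : IsAdicComplete (I.map (algebraMap C B)) B := AdicCompletion.isAdicComplete_self I hIfg
  have c2 : (I.map (algebraMap C B)).IsMaximal := AdicCompletion.isMaximal_map_of_le I I le_rfl hIfg
  have c3 : IsLocalRing B := isLocalRing_of_isAdicComplete_maximal (I.map (algebraMap C B))
  have c4 : I.map (algebraMap C B) = maximalIdeal B := IsLocalRing.eq_maximalIdeal c2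
  have c5 : IsNoetherianRing B := noeth (I.map (algebraMap C B)) (hIfg.map _)
  have : IsScalarTower S0 C B := IsScalarTower.of_algebraMap_eq' rfl
  have mem : ∀ n (x : B), x ∈ m0 ^ n • (⊤ : Submodule S0 B) ↔ AdicCompletion.eval I C n x = 0 := by
    intro n x
    have h1 := AdicCompletion.pow_smul_top_eq_ker_eval (M := C) (n := n) hIfg
    have h2 : I ^ n = (m0 ^ n).map (algebraMap S0 C) := by rw [Ideal.map_pow, ← hI0]
    have h3 : (I ^ n).map (algebraMap C B) = (m0 ^ n).map (algebraMap S0 B) := by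
      rw [h2, Ideal.map_map, ← IsScalarTower.algebraMap_eq]
    rw [← LinearMap.mem_ker, ← h1, Ideal.smul_top_eq_map, Ideal.smul_top_eq_map, ← h3]
    rfl
  have memC : ∀ n (x : C), x ∈ m ^ n • (⊤ : Submodule S C) ↔ x ∈ (I ^ n • ⊤ : Ideal C) := by
    intro n x
    rw [Ideal.smul_top_eq_map, Ideal.map_pow, smul_eq_mul, Ideal.mul_top]
    rfl
  have flat : Module.Flat S0 B := by
    have : Module.Flat S0 (ι →₀ S) := Module.Flat.trans S0 S _
    let φ' : (ι →₀ S) →ₗ[S0] B := ((AdicCompletion.of I C).restrictScalars S0) ∘ₗ (φ.restrictScalars S0)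
    refine flat_of_approx m0 ?_ φ' ?_ ?_
    · have h3 : I.map (algebraMap C B) = m0.map (algebraMap S0 B) := by
        rw [IsScalarTower.algebraMap_eq S0 C B, ← Ideal.map_map, ← hI0]
      rw [← c4, h3]
    · intro n x
      obtain ⟨c, hc⟩ := Submodule.mkQ_surjective _ (AdicCompletion.eval I C n x)
      obtain ⟨z, hz⟩ := (hφ n).1 c
      refine ⟨z, ?_⟩
      rw [mem, map_sub, ← hc]
      rw [memC] at hz
      exact (map_sub (Submodule.mkQ _) c (φ z)).symm.trans ((Submodule.Quotient.mk_eq_zero _).2 hz)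
    · intro n z hz
      rw [mem] at hz
      have h1 : φ z ∈ (I ^ n • ⊤ : Ideal C) := (Submodule.Quotient.mk_eq_zero _).1 hz
      have h2 := (hφ n).2 z ((memC _ _).2 h1)
      rw [← hm0, ← Ideal.map_pow] at h2
      have h3 := Ideal.smul_restrictScalars (m0 ^ n) (⊤ : Submodule S (ι →₀ S))
      rw [Submodule.restrictScalars_top] at h3
      rw [← h3]
      exact h2
  obtain ⟨N, hN⟩ := hnil
  have hker : ∀ a ∈ I ^ N, π a = 0 := by
    intro a ha
    have h1 := Ideal.mem_map_of_mem π ha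
    rw [Ideal.map_pow] at h1
    have h2 : I.map π = maximalIdeal A := by
      rw [← hm, hI]
      have := Ideal.map_map (I := m) (algebraMap S C) (π : C →+* A)
      rw [AlgHom.comp_algebraMap] at this
      exact this
    rw [h2, hN] at h1
    simpa using h1
  let q : C ⧸ I ^ N →+* A := Ideal.Quotient.lift (I ^ N) π.toRingHom hker
  have hq : Function.Surjective q := Ideal.Quotient.lift_surjective_of_surjective _ hker hπ
  refine ⟨B, inferInstance, c3, algebraMap S0 B, q.comp (AdicCompletion.evalₐ I N).toRingHom,
    c5, c4 ▸ c1, RingHom.flat_algebraMap_iff.2 flat, ?_, ?_⟩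
  · rw [RingHom.coe_comp]
    exact hq.comp (AdicCompletion.surjective_evalₐ I N)
  · ext s
    exact π.commutes _
end



section
open IsLocalRing
lemma exists_loc {R A ι : Type u} [CommRing R] [CommRing A] [IsLocalRing A] [Algebra R A] (y : ι → A) :
    ∃ (S : Type u) (_ : CommRing S) (_ : IsLocalRing S) (_ : Algebra R S) (_ : Algebra S A)
      (_ : IsLocalHom (algebraMap S A)) (_ : IsScalarTower R S A) (_ : Module.Flat R S) (t : ι → S),
      (IsNoetherianRing R → Finite ι → IsNoetherianRing S) ∧ (∀ i, algebraMap S A (t i) = y i) ∧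
      maximalIdeal S = ((maximalIdeal A).comap (MvPolynomial.aeval (R := R) y)).map
        (MvPolynomial.aeval (R := R) t) := by
  let ψ : MvPolynomial ι R →ₐ[R] A := MvPolynomial.aeval y
  let p : Ideal (MvPolynomial ι R) := (maximalIdeal A).comap ψ
  have hp : p.IsPrime := Ideal.comap_isPrime ψ _
  let S := Localization.AtPrime p
  have hu : ∀ s : p.primeCompl, IsUnit ((ψ : MvPolynomial ι R →+* A) s) := by
    intro s
    have := s.2
    by_contra h
    exact this ((mem_maximalIdeal _).2 h)
  let l : S →+* A := IsLocalization.lift hu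
  have hl : ∀ q, l (algebraMap _ S q) = ψ q := fun q => IsLocalization.lift_eq hu q
  let _ : Algebra S A := l.toAlgebra
  have hmS : maximalIdeal S = p.map (algebraMap _ S) := (Localization.AtPrime.map_eq_maximalIdeal).symm
  have hloc : IsLocalHom (algebraMap S A) := by
    refine ((local_hom_TFAE (algebraMap S A)).out 2 0).1 ?_
    rw [hmS, Ideal.map_map, Ideal.map_le_iff_le_comap]
    intro q hq
    change l (algebraMap _ S q) ∈ maximalIdeal A
    rw [hl]; exact hq
  have tow : IsScalarTower R S A := by
    refine IsScalarTower.of_algebraMap_eq fun r => ?_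
    rw [IsScalarTower.algebraMap_apply R (MvPolynomial ι R) S]
    change _ = l _
    rw [hl, AlgHom.commutes]
  have fl : Module.Flat R S := by
    have : Module.Flat (MvPolynomial ι R) S := IsLocalization.flat S p.primeCompl
    exact Module.Flat.trans R (MvPolynomial ι R) S
  refine ⟨S, inferInstance, inferInstance, inferInstance, inferInstance, hloc, tow, fl,
    fun i => algebraMap _ S (MvPolynomial.X i : MvPolynomial ι R), ?_, ?_, ?_⟩
  · intro _ _
    exact IsLocalization.isNoetherianRing p.primeCompl S inferInstance
  · intro i
    change l _ = _
    rw [hl]; simp [ψ]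
  · rw [hmS]
    have : MvPolynomial.aeval (fun i => algebraMap _ S (MvPolynomial.X i : MvPolynomial ι R)) =
        IsScalarTower.toAlgHom R (MvPolynomial ι R) S := by
      ext i; simp
    rw [this]
    rfl

lemma exists_S {S0 A : Type u} [CommRing S0] [IsNoetherianRing S0] [IsLocalRing S0]
    [CommRing A] [IsLocalRing A] [Algebra S0 A] [IsLocalHom (algebraMap S0 A)]
    (hm : (maximalIdeal S0).map (algebraMap S0 A) = maximalIdeal A)
    (hnil : ∃ N, maximalIdeal A ^ N = ⊥) :
    ∃ (B : Type u) (_ : CommRing B) (_ : IsLocalRing B) (g : S0 →+* B) (h : B →+* A),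
      IsNoetherianRing B ∧ IsAdicComplete (maximalIdeal B) B ∧ g.Flat ∧ Function.Surjective h ∧
      h.comp g = algebraMap S0 A := by
  obtain ⟨σ, hσ⟩ : ∃ σ : ResidueField A → A, ∀ x, residue A (σ x) = x :=
    ⟨_, Function.surjInv_eq (residue_surjective (R := A))⟩
  obtain ⟨ι, x, hx⟩ := exists_isTranscendenceBasis' (ResidueField S0) (ResidueField A)
  obtain ⟨S, _, _, _, _, hloc, tow, fl, t, -, ht, hmS⟩ := exists_loc (R := S0) (fun i => σ (x i))
  have hm0 : (maximalIdeal S0).map (algebraMap S0 S) = maximalIdeal S := by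
    have h1 : (maximalIdeal A).comap (MvPolynomial.aeval (R := S0) (fun i => σ (x i))) =
        (maximalIdeal S0).map (algebraMap S0 (MvPolynomial ι S0)) := by
      have h2 : (maximalIdeal S0).map (algebraMap S0 (MvPolynomial ι S0)) =
          RingHom.ker (MvPolynomial.map (σ := ι) (residue S0)) := by
        rw [MvPolynomial.ker_map, ker_residue]; rfl
      rw [h2]
      ext q
      have comm : MvPolynomial.aeval (R := ResidueField S0) x (MvPolynomial.map (residue S0) q) =
          residue A (MvPolynomial.aeval (R := S0) (fun i => σ (x i)) q) := by
        have : (MvPolynomial.aeval (R := ResidueField S0) x).toRingHom.comp (MvPolynomial.map (residue S0)) =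
            (residue A).comp (MvPolynomial.aeval (R := S0) (fun i => σ (x i))).toRingHom := by
          apply MvPolynomial.ringHom_ext
          · intro r; simp [ResidueField.algebraMap_residue]
          · intro x; simp [hσ]
        exact congrArg (fun f : MvPolynomial ι S0 →+* ResidueField A => f q) this
      rw [Ideal.mem_comap, ← residue_eq_zero_iff, ← comm, RingHom.mem_ker]
      exact map_eq_zero_iff _ hx.1
    rw [hmS, h1]
    have := Ideal.map_map (I := maximalIdeal S0) (algebraMap S0 (MvPolynomial ι S0)) (MvPolynomial.aeval (R := S0) t).toRingHom
    rw [show (MvPolynomial.aeval (R := S0) t).toRingHom.comp (algebraMap S0 (MvPolynomial ι S0)) = algebraMap S0 S from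
      RingHom.ext fun r => (MvPolynomial.aeval (R := S0) t).commutes r] at this
    exact this.symm
  have hmA : (maximalIdeal S).map (algebraMap S A) = maximalIdeal A := by
    rw [← hm0, Ideal.map_map, ← IsScalarTower.algebraMap_eq, hm]
  have alg : Algebra.IsAlgebraic (ResidueField S) (ResidueField A) := by
    let T := Algebra.adjoin (ResidueField S0) (Set.range x)
    have hT : ∀ a : T, ∃ b, algebraMap (ResidueField S) (ResidueField A) b = a := by
      have : ∀ a ∈ T, a ∈ (algebraMap (ResidueField S) (ResidueField A)).range := by
        intro a ha
        induction ha using Algebra.adjoin_induction with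
        | mem a ha =>
          obtain ⟨i, rfl⟩ := ha
          refine ⟨residue S (t i), ?_⟩
          rw [ResidueField.algebraMap_residue, ht, hσ]
        | algebraMap r =>
          obtain ⟨s, rfl⟩ := residue_surjective r
          refine ⟨residue S (algebraMap S0 S s), ?_⟩
          rw [ResidueField.algebraMap_residue, ResidueField.algebraMap_residue, ← IsScalarTower.algebraMap_apply]
        | add a b _ _ ha hb => exact add_mem ha hb
        | mul a b _ _ ha hb => exact mul_mem ha hb
      exact fun a => this a a.2
    have inj := (algebraMap (ResidueField S) (ResidueField A)).injective
    choose j hj using hT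
    let J : T →+* ResidueField S :=
      { toFun := j
        map_one' := inj (by simp [hj])
        map_zero' := inj (by simp [hj])
        map_add' := fun a b => inj (by simp [hj])
        map_mul' := fun a b => inj (by simp [hj]) }
    let _ : Algebra T (ResidueField S) := J.toAlgebra
    have : IsScalarTower T (ResidueField S) (ResidueField A) :=
      IsScalarTower.of_algebraMap_eq fun a => (hj a).symm
    have : Algebra.IsAlgebraic T (ResidueField A) := hx.isAlgebraic
    refine Algebra.IsAlgebraic.extendScalars (R := T) ?_
    intro a b hab
    apply Subtype.ext
    rw [← hj a, ← hj b]
    exact congrArg _ hab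
  rw [IsScalarTower.algebraMap_eq S0 S A]
  exact exists_B hm0 hmA hnil

end

end Fac

/-- A local homomorphism `f : B →+* A` from a complete Noetherian local ring
to an Artinian local ring factors as `B → B' → A` with `B → B'` a faithfully flat local
morphism of complete Noetherian local rings and `B' → A` surjective. -/
theorem stmt1 {A B : Type u} [CommRing A] [CommRing B]
    [IsArtinianRing A] [IsLocalRing A]
    [IsNoetherianRing B] [IsLocalRing B]
    [IsAdicComplete (IsLocalRing.maximalIdeal B) B]
    (f : B →+* A) [IsLocalHom f] :
    ∃ (B' : Type u) (_ : CommRing B') (_ : IsLocalRing B')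
      (g : B →+* B') (h : B' →+* A),
        IsNoetherianRing B' ∧
        IsAdicComplete (IsLocalRing.maximalIdeal B') B' ∧
        IsLocalHom g ∧
        (letI : Algebra B B' := g.toAlgebra; Module.FaithfullyFlat B B') ∧
        Function.Surjective h ∧
        h.comp g = f := by
  let _ : Algebra B A := f.toAlgebra
  have hfg : (IsLocalRing.maximalIdeal A).FG := IsNoetherian.noetherian _
  obtain ⟨r, y, hy⟩ := Submodule.fg_iff_exists_fin_generating_family.1 hfg
  obtain ⟨S, _, _, _, _, hloc, tow, fl, t, hno, ht, hmS⟩ :=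
    Fac.exists_loc (R := B) (ι := ULift.{u} (Fin r)) (fun i => y i.down)
  have := hno inferInstance inferInstance
  have hm : (IsLocalRing.maximalIdeal S).map (algebraMap S A) = IsLocalRing.maximalIdeal A := by
    apply le_antisymm
    · exact ((IsLocalRing.local_hom_TFAE (algebraMap S A)).out 0 2).1 hloc
    · conv_lhs => rw [← hy]
      refine Submodule.span_le.2 ?_
      rintro _ ⟨i, rfl⟩
      have h1 := ht ⟨i⟩
      rw [← h1]
      refine Ideal.mem_map_of_mem _ ?_
      rw [IsLocalRing.mem_maximalIdeal]
      intro hu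
      have h2 := hu.map (algebraMap S A)
      rw [h1] at h2
      have h3 : y i ∈ IsLocalRing.maximalIdeal A := hy ▸ Submodule.subset_span ⟨i, rfl⟩
      exact (IsLocalRing.mem_maximalIdeal _).1 h3 h2
  have hnil : ∃ N, IsLocalRing.maximalIdeal A ^ N = ⊥ := by
    have := IsArtinianRing.isNilpotent_jacobson_bot (R := A)
    rw [IsLocalRing.jacobson_eq_maximalIdeal _ bot_ne_top] at this
    exact this
  obtain ⟨B', _, _, g, h, h1, h2, h3, h4, h5⟩ := Fac.exists_S hm hnil
  have hc : h.comp (g.comp (algebraMap B S)) = f := by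
    rw [← RingHom.comp_assoc, h5, ← IsScalarTower.algebraMap_eq]; rfl
  have hlocg : IsLocalHom (g.comp (algebraMap B S)) := by
    constructor
    intro a ha
    have := ha.map h
    rw [← RingHom.comp_apply, hc] at this
    exact isUnit_of_map_unit f a this
  refine ⟨B', inferInstance, inferInstance, g.comp (algebraMap B S), h, h1, h2, hlocg, ?_, h4, hc⟩
  have hflat : (g.comp (algebraMap B S)).Flat := RingHom.Flat.comp (RingHom.flat_algebraMap_iff.2 fl) h3
  let _ : Algebra B B' := (g.comp (algebraMap B S)).toAlgebra
  have : Module.Flat B B' := hflat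
  have : IsLocalHom (algebraMap B B') := hlocg
  exact Module.FaithfullyFlat.of_flat_of_isLocalHom
end

section
/- If 𝔐 is a finitely generated projective A[[u]]-module, then 𝔐 is Zariski locally free of finite rank on Spec A: there exist elements f_1,…,f_n of A generating the unit ideal such that 𝔐 ⊗_{A[[u]]} A[1/f_i][[u]] is a free A[1/f_i][[u]]-module of finite rank for each i. -/
open scoped TensorProduct

/-- Nakayama for a surjective ring map with kernel in the Jacobson radical. -/
lemma aux_nakayama {R S Q : Type*} [CommRing R] [CommRing S] [Algebra R S]
    (hs : Function.Surjective (algebraMap R S))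
    (hj : RingHom.ker (algebraMap R S) ≤ (⊥ : Ideal R).jacobson)
    [AddCommGroup Q] [Module R Q] [Module.Finite R Q]
    (h : Subsingleton (S ⊗[R] Q)) : Subsingleton Q := by
  let I := RingHom.ker (Algebra.ofId R S)
  have hs' : Function.Surjective (Algebra.ofId R S) := hs
  let e := (Ideal.quotientKerAlgEquivOfSurjective hs')
  let e2 := (TensorProduct.congr e.toLinearEquiv (LinearEquiv.refl R Q)).symm.trans
    (TensorProduct.quotTensorEquivQuotSMul Q I)
  have : Subsingleton (Q ⧸ (I • (⊤ : Submodule R Q))) := e2.symm.toEquiv.subsingleton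
  rw [Submodule.Quotient.subsingleton_iff] at this
  have h2 := Submodule.eq_bot_of_le_smul_of_le_jacobson_bot I (⊤ : Submodule R Q)
    Module.Finite.fg_top this.ge hj
  exact (Submodule.subsingleton_iff R).mp (subsingleton_of_bot_eq_top h2.symm)

lemma aux_free {R S P : Type*} [CommRing R] [CommRing S] [Algebra R S]
    (hs : Function.Surjective (algebraMap R S))
    (hj : RingHom.ker (algebraMap R S) ≤ (⊥ : Ideal R).jacobson)
    [AddCommGroup P] [Module R P] [Module.Finite R P] [Module.Projective R P]
    [Module.Free S (S ⊗[R] P)] : Module.Free R P := by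
  let b := Module.Free.chooseBasis S (S ⊗[R] P)
  have hl : ∀ i, ∃ p : P, (1 : S) ⊗ₜ[R] p = b i := fun i =>
    TensorProduct.mk_surjective R P S hs (b i)
  choose p hp using hl
  let g : (Module.Free.ChooseBasisIndex S (S ⊗[R] P) → R) →ₗ[R] P := Fintype.linearCombination R p
  have hg1 : ∀ i, g (Pi.single i 1) = p i := fun i => by simp [g]
  -- the base change is bijective
  let G := g.baseChange S
  let c : Module.Basis _ S (S ⊗[R] (Module.Free.ChooseBasisIndex S (S ⊗[R] P) → R)) :=
    (Pi.basisFun R _).baseChange S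
  have hG : G = (c.equiv b (Equiv.refl _)).toLinearMap := by
    apply c.ext
    intro i
    have h1 : c i = (1 : S) ⊗ₜ[R] Pi.single i (1 : R) := by
      simp [c]
    have h2 : (c.equiv b (Equiv.refl _)) (c i) = b i := by simp
    rw [LinearEquiv.coe_coe, h2, h1]
    simp [G, hg1, hp]
  have hGb : Function.Bijective G := by
    rw [hG]; exact (c.equiv b (Equiv.refl _)).bijective
  have hsurj : Function.Surjective g := by
    have : Subsingleton (S ⊗[R] (P ⧸ LinearMap.range g)) := by
      have hz : (LinearMap.range g).mkQ.lTensor S = 0 := by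
        apply LinearMap.ext
        intro x
        obtain ⟨y, rfl⟩ := hGb.2 x
        change ((LinearMap.range g).mkQ.lTensor S) (g.lTensor S y) = 0
        rw [← LinearMap.comp_apply, ← LinearMap.lTensor_comp, LinearMap.range_mkQ_comp]
        simp
      have hsu := LinearMap.lTensor_surjective S (Submodule.mkQ_surjective (LinearMap.range g))
      refine ⟨fun x y => ?_⟩
      obtain ⟨x, rfl⟩ := hsu x
      obtain ⟨y, rfl⟩ := hsu y
      simp [hz]
    have := aux_nakayama hs hj this
    rw [Submodule.Quotient.subsingleton_iff] at this
    exact LinearMap.range_eq_top.mp this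
  obtain ⟨σ, hσ⟩ := Module.projective_lifting_property g LinearMap.id hsurj
  have hσ' : ∀ x, g (σ x) = x := fun x => LinearMap.congr_fun hσ x
  let π : (Module.Free.ChooseBasisIndex S (S ⊗[R] P) → R) →ₗ[R] LinearMap.ker g :=
    (LinearMap.id - σ ∘ₗ g).codRestrict _ (fun x => by simp [hσ'])
  have hπ : π ∘ₗ (LinearMap.ker g).subtype = LinearMap.id := by
    ext x : 2
    have := x.2
    simp [π]
  have hπs : Function.Surjective π := fun x => ⟨x, LinearMap.congr_fun hπ x⟩
  have : Module.Finite R (LinearMap.ker g) := Module.Finite.of_surjective π hπs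
  have hk : Subsingleton (S ⊗[R] LinearMap.ker g) := by
    have hz : ∀ x : S ⊗[R] LinearMap.ker g, x = 0 := by
      intro x
      have h1 : (LinearMap.ker g).subtype.lTensor S x = 0 := by
        apply hGb.1
        change g.lTensor S _ = G 0
        rw [← LinearMap.comp_apply, ← LinearMap.lTensor_comp, LinearMap.comp_ker_subtype]
        simp
      have h2 : π.lTensor S ((LinearMap.ker g).subtype.lTensor S x) = x := by
        rw [← LinearMap.comp_apply, ← LinearMap.lTensor_comp, hπ]
        simp
      rw [← h2, h1, map_zero]
    exact ⟨fun x y => (hz x).trans (hz y).symm⟩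
  have := aux_nakayama hs hj hk
  have hinj : Function.Injective g := by
    rw [← LinearMap.ker_eq_bot]
    exact Submodule.subsingleton_iff_eq_bot.mp this
  exact Module.Free.of_equiv (LinearEquiv.ofBijective g ⟨hinj, hsurj⟩)

lemma aux_square {R A B S M : Type*} [CommRing R] [CommRing A] [CommRing B] [CommRing S]
    [Algebra R A] [Algebra R B] [Algebra A S] [Algebra B S]
    (hc : (algebraMap A S).comp (algebraMap R A) = (algebraMap B S).comp (algebraMap R B))
    (hs : Function.Surjective (algebraMap B S))
    (hj : RingHom.ker (algebraMap B S) ≤ (⊥ : Ideal B).jacobson)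
    [AddCommGroup M] [Module R M] [Module.Finite R M] [Module.Projective R M]
    (hf : Module.Free S (S ⊗[A] (A ⊗[R] M))) :
    ∃ n : ℕ, Nonempty ((B ⊗[R] M) ≃ₗ[B] (Fin n → B)) := by
  letI : Algebra R S := ((algebraMap A S).comp (algebraMap R A)).toAlgebra
  haveI : IsScalarTower R A S := IsScalarTower.of_algebraMap_eq' rfl
  haveI : IsScalarTower R B S := IsScalarTower.of_algebraMap_eq' hc
  let e : S ⊗[B] (B ⊗[R] M) ≃ₗ[S] S ⊗[A] (A ⊗[R] M) :=
    (TensorProduct.AlgebraTensorModule.cancelBaseChange R B S S M).trans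
      (TensorProduct.AlgebraTensorModule.cancelBaseChange R A S S M).symm
  haveI : Module.Free S (S ⊗[B] (B ⊗[R] M)) := Module.Free.of_equiv e.symm
  haveI : Module.Free B (B ⊗[R] M) := aux_free (S := S) hs hj
  let b := Module.Free.chooseBasis B (B ⊗[R] M)
  exact ⟨_, ⟨(b.reindex (Fintype.equivFin _)).equivFun⟩⟩

lemma aux_loc (A N : Type*) [CommRing A] [AddCommGroup N] [Module A N] [Module.Finite A N]
    [Module.Projective A N] :
    ∃ s : Finset A, Ideal.span (s : Set A) = ⊤ ∧
      ∀ f ∈ s, Module.Free (Localization.Away f) (Localization.Away f ⊗[A] N) := by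
  let T : Set A := {f | Module.Free (Localization.Away f) (Localization.Away f ⊗[A] N)}
  have hT : Ideal.span T = ⊤ := by
    by_contra hne
    obtain ⟨m, hm, hle⟩ := Ideal.exists_le_maximal _ hne
    haveI := Module.finitePresentation_of_projective A N
    have hx : (⟨m, hm.isPrime⟩ : PrimeSpectrum A) ∈ Module.freeLocus A N := by
      rw [Module.freeLocus_eq_univ]; trivial
    have : Module.Free _ _ := hx
    obtain ⟨r, hr, hr', _⟩ := Module.FinitePresentation.exists_free_localizedModule_powers
      m.primeCompl (LocalizedModule.mkLinearMap m.primeCompl N) (Localization.AtPrime m)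
    apply hr
    apply hle
    apply Ideal.subset_span
    exact Module.Free.of_equiv (LocalizedModule.equivTensorProduct (Submonoid.powers r) N)
  obtain ⟨s, hsT, hs⟩ := (Ideal.span_eq_top_iff_finite T).mp hT
  exact ⟨s, hs, fun f hf => hsT hf⟩

/-- A finitely generated projective `A[[u]]`-module is Zariski locally free of
finite rank on `Spec A`: there are elements `f₁, …, fₙ` of `A` generating the unit ideal such
that the base change of `𝔐` to `A[1/fᵢ][[u]]` is finite free for each `i`. -/
theorem stmt3 {A : Type*} [CommRing A] {M : Type*} [AddCommGroup M]
    [Module (PowerSeries A) M] [Module.Finite (PowerSeries A) M]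
    [Module.Projective (PowerSeries A) M] :
    ∃ s : Finset A, Ideal.span (s : Set A) = ⊤ ∧
      ∀ f ∈ s,
        letI : Algebra (PowerSeries A) (PowerSeries (Localization.Away f)) :=
          (PowerSeries.map (algebraMap A (Localization.Away f))).toAlgebra
        ∃ n : ℕ, Nonempty
          ((TensorProduct (PowerSeries A) (PowerSeries (Localization.Away f)) M)
            ≃ₗ[PowerSeries (Localization.Away f)]
              (Fin n → PowerSeries (Localization.Away f))) := by
  letI : Algebra (PowerSeries A) A := (PowerSeries.constantCoeff (R := A)).toAlgebra
  obtain ⟨s, hs, h⟩ := aux_loc A (A ⊗[PowerSeries A] M)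
  refine ⟨s, hs, fun f hf => ?_⟩
  letI : Algebra (PowerSeries A) (PowerSeries (Localization.Away f)) :=
    (PowerSeries.map (algebraMap A (Localization.Away f))).toAlgebra
  letI : Algebra (PowerSeries (Localization.Away f)) (Localization.Away f) :=
    (PowerSeries.constantCoeff (R := Localization.Away f)).toAlgebra
  refine aux_square (A := A) (S := Localization.Away f) ?_ ?_ ?_ (h f hf)
  · ext x
    change algebraMap A (Localization.Away f) (PowerSeries.constantCoeff x) =
      PowerSeries.constantCoeff (PowerSeries.map (algebraMap A (Localization.Away f)) x)
    rw [← PowerSeries.coeff_zero_eq_constantCoeff_apply,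
      ← PowerSeries.coeff_zero_eq_constantCoeff_apply, PowerSeries.coeff_map]
  · exact fun x => ⟨PowerSeries.C x, by simp [RingHom.algebraMap_toAlgebra]⟩
  · intro x hx
    have hx : PowerSeries.constantCoeff x = 0 := hx
    rw [Ideal.mem_jacobson_bot]
    intro y
    rw [PowerSeries.isUnit_iff_constantCoeff]
    simp [hx]
end

section
/- Let A be a commutative ring, let 𝔐 be an A[[u]]-module which is u-torsion free and u-adically complete and separated. If there is a faithfully flat A-algebra A' such that 𝔐 ⊗_{A[[u]]} A'[[u]] is a free A'[[u]]-module of finite rank, then 𝔐 is a finitely generated projective A[[u]]-module. -/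
open scoped TensorProduct

theorem proj_descent {A N : Type*} [CommRing A] [AddCommGroup N] [Module A N] (B : Type*) [CommRing B]
    [Algebra A B] [Module.FaithfullyFlat A B] [Module.Finite B (B ⊗[A] N)]
    [Module.Projective B (B ⊗[A] N)] : Module.Finite A N ∧ Module.Projective A N := by
  have hfin : Module.Finite A N := Module.Finite.of_finite_tensorProduct_of_faithfullyFlat B
  have hfl : Module.Flat A N := Module.Flat.of_flat_tensorProduct A N B
  refine ⟨hfin, ?_⟩
  obtain ⟨k, g, hg⟩ := Module.Finite.exists_fin' A N
  have hK : Module.Finite B (B ⊗[A] (LinearMap.ker g)) := by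
    let i := (LinearMap.ker g).subtype.baseChange B
    let p := g.baseChange B
    have hi : Function.Injective i :=
      Module.Flat.lTensor_preserves_injective_linearMap (M := B) _ (Submodule.subtype_injective _)
    have hp : Function.Surjective p := LinearMap.lTensor_surjective B hg
    have hex : Function.Exact i p :=
      lTensor_exact B (LinearMap.exact_subtype_ker_map g) hg
    obtain ⟨s, hs⟩ := Module.projective_lifting_property p LinearMap.id hp
    have hsp := (hex.split_tfae' (R := B)).out 0 1
    obtain ⟨-, l, hl⟩ := hsp.1 ⟨hi, s, hs⟩
    exact Module.Finite.of_surjective l (fun x => ⟨i x, LinearMap.congr_fun hl x⟩)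
  have hK' : Module.Finite A (LinearMap.ker g) := Module.Finite.of_finite_tensorProduct_of_faithfullyFlat B
  have : Module.FinitePresentation A N :=
    Module.finitePresentation_of_free_of_surjective g hg (Module.Finite.iff_fg.1 hK')
  exact Module.Flat.projective_of_finitePresentation

theorem precomplete_of_finite {R P : Type*} [CommRing R] [AddCommGroup P] [Module R P] (I : Ideal R)
    [IsPrecomplete I R] [Module.Finite R P] : IsPrecomplete I P := by
  rw [← AdicCompletion.of_surjective_iff]
  intro y
  obtain ⟨t, rfl⟩ := AdicCompletion.ofTensorProduct_surjective_of_finite I P y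
  induction t with
  | zero => exact ⟨0, by simp⟩
  | add a b ha hb =>
    obtain ⟨x, hx⟩ := ha
    obtain ⟨y, hy⟩ := hb
    exact ⟨x + y, by simp [hx, hy]⟩
  | tmul r m =>
    obtain ⟨r, rfl⟩ := AdicCompletion.of_surjective I R r
    refine ⟨r • m, ?_⟩
    rw [AdicCompletion.ofTensorProduct_tmul]
    ext n
    simp
    rfl

theorem ker_mk_one {R A Q : Type*} [CommRing R] [CommRing A] [Algebra R A] [AddCommGroup Q] [Module R Q]
    (hs : Function.Surjective (algebraMap R A)) (t : R)
    (hk : RingHom.ker (algebraMap R A) = Ideal.span {t}) (x : Q) :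
    (1 : A) ⊗ₜ[R] x = 0 ↔ x ∈ (Ideal.span {t} • ⊤ : Submodule R Q) := by
  rw [← hk, ← LinearMap.ker_tensorProductMk, LinearMap.mem_ker]
  let e := Ideal.quotientKerAlgEquivOfSurjective (f := Algebra.ofId R A) hs
  let e' := TensorProduct.congr e.toLinearEquiv (LinearEquiv.refl R Q)
  have : e' ((1 : R ⧸ RingHom.ker (algebraMap R A)) ⊗ₜ[R] x) = (1 : A) ⊗ₜ[R] x := by
    change e 1 ⊗ₜ x = _
    rw [map_one]
  rw [← this, LinearEquiv.map_eq_zero_iff, TensorProduct.mk_apply]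
  rfl

theorem core {R A M : Type*} [CommRing R] [CommRing A] [Algebra A R] [Algebra R A] [IsScalarTower A R A]
    [AddCommGroup M] [Module R M] (t : R)
    (hk : RingHom.ker (algebraMap R A) = Ideal.span {t})
    [IsAdicComplete (Ideal.span {t}) R]
    [IsAdicComplete (Ideal.span {t}) M] (htf : ∀ m : M, t • m = 0 → m = 0)
    [Module.Finite A (A ⊗[R] M)] [Module.Projective A (A ⊗[R] M)] :
    Module.Finite R M ∧ Module.Projective R M := by
  have hs : Function.Surjective (algebraMap R A) := fun a => ⟨algebraMap A R a, by
    rw [← IsScalarTower.algebraMap_apply]; rfl⟩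
  let P := R ⊗[A] (A ⊗[R] M)
  have : IsPrecomplete (Ideal.span {t}) P := precomplete_of_finite _
  let c : A ⊗[R] P ≃ₗ[R] A ⊗[R] M :=
    ((TensorProduct.AlgebraTensorModule.cancelBaseChange A R A A (A ⊗[R] M)).trans
      (TensorProduct.lid A (A ⊗[R] M))).restrictScalars R
  let πP : P →ₗ[R] A ⊗[R] M := c.toLinearMap ∘ₗ TensorProduct.mk R A P 1
  let πM : M →ₗ[R] A ⊗[R] M := TensorProduct.mk R A M 1
  have hπM : Function.Surjective πM := TensorProduct.mk_surjective R M A hs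
  have hπP : Function.Surjective πP := c.surjective.comp (TensorProduct.mk_surjective R P A hs)
  obtain ⟨f, hf⟩ := Module.projective_lifting_property πM πP hπM
  have hf' : ∀ p, πM (f p) = πP p := fun p => LinearMap.congr_fun hf p
  have hsurj : Function.Surjective f := by
    refine surjective_of_mkQ_comp_surjective (I := Ideal.span {t}) ?_
    intro y
    obtain ⟨m, rfl⟩ := Submodule.mkQ_surjective _ y
    obtain ⟨p, hp⟩ := hπP (πM m)
    refine ⟨p, ?_⟩
    rw [LinearMap.comp_apply, ← sub_eq_zero, ← map_sub, Submodule.mkQ_apply,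
      Submodule.Quotient.mk_eq_zero, ← ker_mk_one hs t hk]
    change πM _ = 0
    rw [map_sub, hf', hp, sub_self]
  have step : ∀ p, f p = 0 → ∃ q, f q = 0 ∧ p = t • q := by
    intro p hp
    have h1 : πP p = 0 := by rw [← hf', hp, map_zero]
    have h2 : (1 : A) ⊗ₜ[R] p = 0 := by
      simpa [πP] using h1
    rw [ker_mk_one hs t hk, Submodule.ideal_span_singleton_smul,
      Submodule.mem_smul_pointwise_iff_exists] at h2
    obtain ⟨q, -, rfl⟩ := h2
    exact ⟨q, htf _ (by rw [← map_smul, hp]), rfl⟩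
  have hpow : ∀ n p, f p = 0 → ∃ q, f q = 0 ∧ p = t ^ n • q := by
    intro n
    induction n with
    | zero => intro p hp; exact ⟨p, hp, by simp⟩
    | succ n ih =>
      intro p hp
      obtain ⟨q, hq, rfl⟩ := ih p hp
      obtain ⟨r, hr, rfl⟩ := step q hq
      exact ⟨r, hr, by rw [pow_succ, mul_smul]⟩
  have hinj : Function.Injective f := by
    rw [injective_iff_map_eq_zero]
    intro p hp
    obtain ⟨s, hs⟩ := Module.projective_def.1 (inferInstance : Module.Projective R P)
    have : s p = 0 := by
      ext i
      refine IsHausdorff.haus (inferInstance : IsHausdorff (Ideal.span {t}) R) _ fun n => ?_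
      obtain ⟨q, -, rfl⟩ := hpow n p hp
      rw [SModEq.zero, map_smul, Finsupp.smul_apply]
      exact Submodule.smul_mem_smul (Ideal.pow_mem_pow (Ideal.mem_span_singleton_self t) n) trivial
    have h3 := hs p
    rw [this, map_zero] at h3
    exact h3.symm
  let e := LinearEquiv.ofBijective f ⟨hinj, hsurj⟩
  exact ⟨Module.Finite.equiv e, Module.Projective.of_equiv e⟩

theorem abstract_form {R R' A A' M : Type*} [CommRing R] [CommRing R'] [CommRing A] [CommRing A']
    [AddCommGroup M] [Module R M]
    [Algebra A R] [Algebra R A] [IsScalarTower A R A] [Algebra A A'] [Module.FaithfullyFlat A A']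
    [Algebra R R'] [Algebra R' A'] [Algebra R A'] [IsScalarTower R A A'] [IsScalarTower R R' A']
    (t : R) (hk : RingHom.ker (algebraMap R A) = Ideal.span {t})
    (hR : IsAdicComplete (Ideal.span {t}) R)
    (hM : IsAdicComplete (Ideal.span {t}) M) (htf : ∀ m : M, t • m = 0 → m = 0)
    (n : ℕ) (e : (R' ⊗[R] M) ≃ₗ[R'] (Fin n → R')) :
    Module.Finite R M ∧ Module.Projective R M := by
  have hmf : Module.Finite R' (R' ⊗[R] M) := Module.Finite.equiv e.symm
  have hmp : Module.Projective R' (R' ⊗[R] M) := Module.Projective.of_equiv e.symm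
  let e1 : A' ⊗[R'] (R' ⊗[R] M) ≃ₗ[A'] A' ⊗[R] M :=
    TensorProduct.AlgebraTensorModule.cancelBaseChange _ _ _ _ _
  let e2 : A' ⊗[A] (A ⊗[R] M) ≃ₗ[A'] A' ⊗[R] M :=
    TensorProduct.AlgebraTensorModule.cancelBaseChange _ _ _ _ _
  have h1 : Module.Finite A' (A' ⊗[A] (A ⊗[R] M)) := Module.Finite.equiv (e1.trans e2.symm)
  have h2 : Module.Projective A' (A' ⊗[A] (A ⊗[R] M)) :=
    Module.Projective.of_equiv (e1.trans e2.symm)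
  obtain ⟨h3, h4⟩ := proj_descent (A := A) (N := A ⊗[R] M) A'
  exact core (A := A) t hk htf

/-- If `𝔐` is a `u`-torsion free, `u`-adically complete and separated
`A[[u]]`-module and there is a faithfully flat `A`-algebra `A'` such that
`𝔐 ⊗_{A[[u]]} A'[[u]]` is finite free, then `𝔐` is a finitely generated projective
`A[[u]]`-module. -/
theorem stmt4 {A : Type*} [CommRing A] {M : Type*} [AddCommGroup M]
    [Module (PowerSeries A) M]
    (htf : ∀ m : M, (PowerSeries.X : PowerSeries A) • m = 0 → m = 0)
    (hcomplete : IsAdicComplete (Ideal.span {(PowerSeries.X : PowerSeries A)}) M)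
    (A' : Type*) [CommRing A'] [Algebra A A'] [Module.FaithfullyFlat A A']
    (hfree :
      letI : Algebra (PowerSeries A) (PowerSeries A') :=
        (PowerSeries.map (algebraMap A A')).toAlgebra
      ∃ n : ℕ, Nonempty
        ((TensorProduct (PowerSeries A) (PowerSeries A') M)
          ≃ₗ[PowerSeries A'] (Fin n → PowerSeries A'))) :
    Module.Finite (PowerSeries A) M ∧ Module.Projective (PowerSeries A) M := by
  obtain ⟨n, ⟨e⟩⟩ := hfree
  refine @abstract_form (PowerSeries A) (PowerSeries A') A A' M _ _ _ _ _ _ _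
    (PowerSeries.constantCoeff (R := A)).toAlgebra ?_ _ _
    (PowerSeries.map (algebraMap A A')).toAlgebra
    (PowerSeries.constantCoeff (R := A')).toAlgebra
    ((algebraMap A A').comp (PowerSeries.constantCoeff (R := A))).toAlgebra ?_ ?_
    PowerSeries.X ?_ inferInstance hcomplete htf n e
  · refine @IsScalarTower.of_algebraMap_eq _ _ _ _ _ _ _ (_) _ fun a => ?_
    exact (PowerSeries.constantCoeff_C a).symm
  · exact @IsScalarTower.of_algebraMap_eq _ _ _ _ _ _ (_) _ (_) fun a => rfl
  · refine @IsScalarTower.of_algebraMap_eq _ _ _ _ _ _ (_) (_) (_) fun a => ?_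
    change algebraMap A A' (PowerSeries.constantCoeff a) =
      PowerSeries.constantCoeff (PowerSeries.map (algebraMap A A') a)
    rw [← PowerSeries.coeff_zero_eq_constantCoeff_apply,
      ← PowerSeries.coeff_zero_eq_constantCoeff_apply, PowerSeries.coeff_map]
  · ext x
    rw [RingHom.mem_ker, Ideal.mem_span_singleton, PowerSeries.X_dvd_iff]
    rfl
end

section
/- Let A be a Noetherian commutative ring and A → B an fppf (flat and of finite presentation, with surjective induced map on spectra) ring map. Then both induced maps A[[u]] → B[[u]] and A((u)) → B((u)) are faithfully flat. -/
lemma flat_of_approx {C D : Type*} [CommRing C] [IsNoetherianRing C] [CommRing D] [Algebra C D]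
    (t : C) [hD : IsAdicComplete (Ideal.span {algebraMap C D t}) D]
    (h1 : ∀ (n : ℕ) (c : C), (algebraMap C D t) ^ n ∣ algebraMap C D c → t ^ n ∣ c)
    (h2 : ∀ (n : ℕ) (d : D), ∃ c : C, (algebraMap C D t) ^ n ∣ d - algebraMap C D c) :
    Module.Flat C D := by
  let I : Ideal C := Ideal.span {t}
  have hI : ∀ n : ℕ, ∀ d : D, d ∈ (I ^ n • ⊤ : Submodule C D) ↔ (algebraMap C D t) ^ n ∣ d := by
    intro n d
    rw [Ideal.smul_top_eq_map, Submodule.restrictScalars_mem, Ideal.map_pow, Ideal.map_span,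
      Set.image_singleton, Ideal.span_singleton_pow, Ideal.mem_span_singleton]
  have hI' : ∀ n : ℕ, ∀ d : C, d ∈ (I ^ n • ⊤ : Submodule C C) ↔ t ^ n ∣ d := by
    intro n d
    rw [smul_eq_mul, Ideal.mul_top, Ideal.span_singleton_pow, Ideal.mem_span_singleton]
  have hc : IsAdicComplete I D := by
    rw [← IsAdicComplete.map_algebraMap_iff (S := D), Ideal.map_span, Set.image_singleton]
    exact hD
  let φ : C →ₗ[C] D := Algebra.linearMap C D
  have hφ : Function.Bijective (AdicCompletion.map I φ) := by
    constructor
    · rw [injective_iff_map_eq_zero]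
      intro x hx
      induction x using AdicCompletion.induction_on with
      | _ a =>
      apply AdicCompletion.ext
      intro n
      have := congrArg (fun y => AdicCompletion.eval I D n y) hx
      rw [AdicCompletion.map_mk] at this
      change Submodule.Quotient.mk (φ (a n)) = Submodule.Quotient.mk 0 at this
      change Submodule.Quotient.mk (a n) = Submodule.Quotient.mk 0
      rw [Submodule.Quotient.eq, sub_zero] at this ⊢
      rw [hI']
      rw [hI] at this
      exact h1 n _ this
    · intro y
      obtain ⟨d, rfl⟩ := AdicCompletion.of_surjective I D y
      choose c hc using fun n => h2 n d
      refine ⟨AdicCompletion.mk I C (AdicCompletion.AdicCauchySequence.mk I C c ?_), ?_⟩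
      · intro n
        rw [SModEq.sub_mem, hI']
        apply h1
        rw [map_sub]
        have e1 := hc n
        have e2 := (pow_dvd_pow (algebraMap C D t) (Nat.le_succ n)).trans (hc (n+1))
        have := dvd_sub e2 e1
        rwa [sub_sub_sub_cancel_left] at this
      · rw [AdicCompletion.map_mk]
        apply AdicCompletion.ext
        intro n
        change Submodule.Quotient.mk (φ (c n)) = Submodule.Quotient.mk d
        symm
        rw [Submodule.Quotient.eq, hI]
        exact hc n
  let e : AdicCompletion I C ≃ₗ[C] AdicCompletion I D :=
    LinearEquiv.ofBijective ((AdicCompletion.map I φ).restrictScalars C) hφ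
  exact Module.Flat.of_linearEquiv ((AdicCompletion.ofLinearEquiv I D).trans e.symm)

open PowerSeries TensorProduct in
lemma powerSeries_map_flat {A B : Type*} [CommRing A] [IsNoetherianRing A] [CommRing B]
    [Algebra A B] [Module.Flat A B] (hft : Algebra.FiniteType A B) :
    (PowerSeries.map (algebraMap A B)).Flat := by
  let C := A⟦X⟧ ⊗[A] B
  have hCft : Algebra.FiniteType A⟦X⟧ C := inferInstance
  have hC : IsNoetherianRing C := Algebra.FiniteType.isNoetherianRing A⟦X⟧ C
  let ψ : C →ₐ[A] B⟦X⟧ := Algebra.TensorProduct.lift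
    (PowerSeries.mapAlgHom (Algebra.ofId A B)) (IsScalarTower.toAlgHom A B B⟦X⟧)
    (fun _ _ => Commute.all _ _)
  have hψ : ∀ f b, ψ (f ⊗ₜ b) = PowerSeries.map (algebraMap A B) f * PowerSeries.C b := by
    intro f b
    rfl
  let t : C := (X : A⟦X⟧) ⊗ₜ 1
  have ht : ψ t = X := by
    simp [t, hψ]
  have htp : ∀ n (f : A⟦X⟧) (b : B), t ^ n * f ⊗ₜ b = (X ^ n * f) ⊗ₜ b := by
    intro n f b
    have h1 : t ^ n = (X ^ n : A⟦X⟧) ⊗ₜ[A] (1 : B) := by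
      change ((X : A⟦X⟧) ⊗ₜ[A] (1 : B)) ^ n = _
      rw [Algebra.TensorProduct.tmul_pow, one_pow]
    rw [h1]
    change ((X ^ n : A⟦X⟧) ⊗ₜ[A] (1 : B)) * (f ⊗ₜ[A] b) = _
    rw [Algebra.TensorProduct.tmul_mul_tmul, one_mul]
  -- normal form
  have hnf : ∀ n (c : C), ∃ b : ℕ → B, t ^ n ∣ c - ∑ j ∈ Finset.range n, (X ^ j : A⟦X⟧) ⊗ₜ b j := by
    intro n c
    induction c using TensorProduct.induction_on with
    | zero => exact ⟨0, by simp⟩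
    | add x y hx hy =>
      obtain ⟨b, hb⟩ := hx
      obtain ⟨b', hb'⟩ := hy
      refine ⟨b + b', ?_⟩
      have := dvd_add hb hb'
      simp only [Pi.add_apply, TensorProduct.tmul_add, Finset.sum_add_distrib]
      rwa [add_sub_add_comm]
    | tmul f b =>
      refine ⟨fun j => coeff j f • b, ?_⟩
      have h : (X ^ n : A⟦X⟧) ∣ f - ∑ j ∈ Finset.range n, coeff j f • X ^ j := by
        rw [PowerSeries.X_pow_dvd_iff]
        intro m hm
        simp [coeff_X_pow, hm]
      obtain ⟨g, hg⟩ := h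
      refine ⟨g ⊗ₜ b, ?_⟩
      rw [htp, ← hg, TensorProduct.sub_tmul, TensorProduct.sum_tmul]
      simp only [TensorProduct.smul_tmul]
  have hco : ∀ n (b : ℕ → B) m, m < n →
      coeff m (ψ (∑ j ∈ Finset.range n, (X ^ j : A⟦X⟧) ⊗ₜ b j)) = b m := by
    intro n b m hm
    simp [hψ, coeff_X_pow, coeff_mul_C, hm]
  letI : Algebra C B⟦X⟧ := ψ.toRingHom.toAlgebra
  have ham : ∀ c, algebraMap C B⟦X⟧ c = ψ c := fun _ => rfl
  haveI : IsAdicComplete (Ideal.span {algebraMap C B⟦X⟧ t}) B⟦X⟧ := by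
    rw [ham, ht]; infer_instance
  have hflat : Module.Flat C B⟦X⟧ := by
    apply flat_of_approx t
    · intro n c hc
      obtain ⟨b, hb⟩ := hnf n c
      have hb0 : ∀ m < n, b m = 0 := by
        intro m hm
        rw [← hco n b m hm]
        have h3 := map_dvd ψ hb
        rw [map_pow, map_sub, ht] at h3
        rw [ham, ham, ht] at hc
        have h4 := (dvd_sub_right hc).1 h3
        exact PowerSeries.X_pow_dvd_iff.1 h4 m hm
      rw [Finset.sum_eq_zero, sub_zero] at hb
      · exact hb
      · intro j hj
        rw [hb0 j (Finset.mem_range.1 hj), TensorProduct.tmul_zero]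
    · intro n d
      refine ⟨∑ j ∈ Finset.range n, (X ^ j : A⟦X⟧) ⊗ₜ coeff j d, ?_⟩
      rw [ham, ham, ht, PowerSeries.X_pow_dvd_iff]
      intro m hm
      rw [map_sub, hco n (fun j => coeff j d) m hm, sub_self]
  have h1 : (algebraMap A⟦X⟧ C).Flat := RingHom.flat_algebraMap_iff.2 inferInstance
  have h2 : (algebraMap C B⟦X⟧).Flat := RingHom.flat_algebraMap_iff.2 hflat
  have h3 := RingHom.Flat.comp h1 h2
  convert h3 using 1
  ext1 f
  change _ = ψ (f ⊗ₜ 1)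
  rw [hψ, map_one, mul_one]

lemma powerSeries_map_faithfullyFlat {A B : Type*} [CommRing A] [IsNoetherianRing A] [CommRing B]
    [Algebra A B] [Module.Flat A B] (hft : Algebra.FiniteType A B)
    (hsurj : Function.Surjective (PrimeSpectrum.comap (algebraMap A B))) :
    (PowerSeries.map (algebraMap A B)).FaithfullyFlat := by
  have hfl := powerSeries_map_flat (A := A) (B := B) hft
  letI := (PowerSeries.map (algebraMap A B)).toAlgebra
  have hfl' : Module.Flat (PowerSeries A) (PowerSeries B) := hfl
  change Module.FaithfullyFlat (PowerSeries A) (PowerSeries B)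
  refine ⟨fun m hm htop => ?_⟩
  rw [Ideal.smul_top_eq_map, Submodule.restrictScalars_eq_top_iff] at htop
  let m0 : Ideal A := m.map PowerSeries.constantCoeff
  have hm0 : m0 ≠ ⊤ := by
    intro h
    have h1 : (1 : A) ∈ m0 := h ▸ trivial
    obtain ⟨f, hf, hf1⟩ :=
      (Ideal.mem_map_iff_of_surjective _ PowerSeries.constantCoeff_surj).1 h1
    exact hm.ne_top (Ideal.eq_top_of_isUnit_mem _ hf
      (PowerSeries.isUnit_iff_constantCoeff.2 (by rw [hf1]; exact isUnit_one)))
  obtain ⟨p, hp, hmp⟩ := Ideal.exists_le_maximal m0 hm0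
  obtain ⟨q, hq⟩ := hsurj ⟨p, hp.isPrime⟩
  have hle : m.map (algebraMap (PowerSeries A) (PowerSeries B)) ≤
      q.asIdeal.comap PowerSeries.constantCoeff := by
    rw [Ideal.map_le_iff_le_comap]
    intro f hf
    have h1 : PowerSeries.constantCoeff f ∈ p := hmp (Ideal.mem_map_of_mem _ hf)
    have h2 : p = q.asIdeal.comap (algebraMap A B) := by
      rw [← PrimeSpectrum.comap_asIdeal, hq]
    rw [h2] at h1
    change PowerSeries.constantCoeff (PowerSeries.map (algebraMap A B) f) ∈ q.asIdeal
    rw [← PowerSeries.coeff_zero_eq_constantCoeff_apply, PowerSeries.coeff_map,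
      PowerSeries.coeff_zero_eq_constantCoeff_apply]
    exact h1
  rw [htop] at hle
  have : (1 : PowerSeries B) ∈ q.asIdeal.comap PowerSeries.constantCoeff := hle trivial
  rw [Ideal.mem_comap, map_one] at this
  exact q.isPrime.ne_top ((Ideal.eq_top_iff_one _).2 this)


lemma awayMap_faithfullyFlat {R S : Type*} [CommRing R] [CommRing S] (f : R →+* S) (r : R)
    (hf : f.FaithfullyFlat) : (Localization.awayMap f r).FaithfullyFlat := by
  let R' := Localization.Away r
  let S' := Localization.Away (f r)
  let : Algebra R S := f.toAlgebra
  let : Algebra R' S' := (Localization.awayMap f r).toAlgebra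
  have : IsScalarTower R S S' := inferInstance
  have : IsScalarTower R R' S' := IsScalarTower.of_algebraMap_eq' (by
    ext x
    rw [IsScalarTower.algebraMap_apply R S S']
    change algebraMap S S' (f x) = Localization.awayMap f r (algebraMap R R' x)
    simp only [Localization.awayMap, IsLocalization.Away.map]
    rw [IsLocalization.map_eq])
  have : IsLocalization (Algebra.algebraMapSubmonoid S (Submonoid.powers r)) S' := by
    rw [Algebra.algebraMapSubmonoid, Submonoid.map_powers]
    exact (inferInstance : IsLocalization (Submonoid.powers (f r)) S')
  have hff : Module.FaithfullyFlat R S := hf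
  have hl : IsLocalizedModule (Submonoid.powers r) (IsScalarTower.toAlgHom R S S').toLinearMap :=
    inferInstance
  have hb := IsLocalizedModule.isBaseChange (Submonoid.powers r) R'
    (IsScalarTower.toAlgHom R S S').toLinearMap
  change Module.FaithfullyFlat R' S'
  exact Module.FaithfullyFlat.of_linearEquiv _ _ hb.equiv.symm

/-- If `A` is Noetherian and `A → B` is fppf (flat, of finite presentation,
and surjective on prime spectra), then the induced maps `A[[u]] → B[[u]]` and
`A((u)) → B((u))` (the latter realised as localizations away from `u`) are faithfully
flat. -/
theorem stmt5 {A B : Type*} [CommRing A] [IsNoetherianRing A] [CommRing B] [Algebra A B]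
    [Module.Flat A B] (hfp : (algebraMap A B).FinitePresentation)
    (hsurj : Function.Surjective (PrimeSpectrum.comap (algebraMap A B))) :
    (letI : Algebra (PowerSeries A) (PowerSeries B) :=
      (PowerSeries.map (algebraMap A B)).toAlgebra
     Module.FaithfullyFlat (PowerSeries A) (PowerSeries B)) ∧
    (letI : Algebra (Localization.Away (PowerSeries.X : PowerSeries A))
        (Localization.Away ((PowerSeries.map (algebraMap A B)) PowerSeries.X)) :=
      (Localization.awayMap (PowerSeries.map (algebraMap A B)) PowerSeries.X).toAlgebra
     Module.FaithfullyFlat (Localization.Away (PowerSeries.X : PowerSeries A))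
       (Localization.Away ((PowerSeries.map (algebraMap A B)) PowerSeries.X))) := by
  have hft : Algebra.FiniteType A B := by
    have h := RingHom.FiniteType.of_finitePresentation hfp
    rwa [RingHom.finiteType_algebraMap] at h
  have h := powerSeries_map_faithfullyFlat (A := A) (B := B) hft hsurj
  exact ⟨h, awayMap_faithfullyFlat _ _ h⟩
end

section
/- Let A be a commutative ring, M a finitely generated projective A((u))-module, and L an A[[u]]-submodule of M. Then L is a finitely generated projective A[[u]]-module with A((u))·L = M if and only if L is open in M (for the natural topology), every quotient L/U of L by an open submodule U ⊆ L is a finitely generated A-module, and M/L is a projective A-module. -/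
/-- An `A`-submodule (or subset) `U` of a finitely generated projective `A((u))`-module `M`
is **open** for the natural (Tate module) topology on `M` precisely when it contains a
finitely generated `A[[u]]`-submodule which generates `M` over `A((u))`; we use this as the
definition of openness. -/
def IsLatticeOpen (A : Type*) [CommRing A] {M : Type*} [AddCommGroup M]
    [Module (PowerSeries A) M] [Module (LaurentSeries A) M] (U : Set M) : Prop :=
  ∃ Λ : Submodule (PowerSeries A) M, Λ.FG ∧
    Submodule.span (LaurentSeries A) (Λ : Set M) = ⊤ ∧ (Λ : Set M) ⊆ U

namespace Stmt6Aux

open PowerSeries TensorProduct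

variable {A : Type*} [CommRing A]

theorem smul_decomp {L : Type*} [AddCommGroup L] [Module A L] [Module (PowerSeries A) L]
    [IsScalarTower A (PowerSeries A) L] (r : PowerSeries A) :
    ∃ r' : PowerSeries A, ∀ x : L,
      r • x = constantCoeff r • x + (X : PowerSeries A) • r' • x := by
  refine ⟨PowerSeries.mk fun p => coeff (p + 1) r, fun x => ?_⟩
  conv_lhs => rw [eq_X_mul_shift_add_const r]
  rw [add_smul, mul_smul, add_comm]
  congr 1
  rw [← algebraMap_smul (PowerSeries A) (constantCoeff r) x]
  rfl

theorem X_mem_jac : Ideal.span {(X : PowerSeries A)} ≤ Ideal.jacobson ⊥ := by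
  rw [Ideal.span_singleton_le_iff_mem, Ideal.mem_jacobson_bot]
  intro y
  rw [PowerSeries.isUnit_iff_constantCoeff]
  simp

theorem sep {P : Type*} [AddCommGroup P] [Module (PowerSeries A) P]
    [Module.Projective (PowerSeries A) P] (x : P)
    (h : ∀ n : ℕ, ∃ y : P, x = (X : PowerSeries A) ^ n • y) : x = 0 := by
  obtain ⟨s, hs⟩ := (Module.projective_def' (R := PowerSeries A) (P := P)).1 inferInstance
  have h0 : s x = 0 := by
    ext p n
    obtain ⟨y, hy⟩ := h (n + 1)
    have : (s x) p = X ^ (n + 1) * (s y) p := by rw [hy]; simp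
    rw [this]
    simpa using X_pow_dvd_iff.1 (Dvd.intro _ rfl) n (Nat.lt_succ_self n)
  have := congrArg (fun f => f x) hs
  simpa [h0] using this.symm

theorem proj_of_special {L P : Type*} [AddCommGroup L] [Module A L] [Module (PowerSeries A) L]
    [IsScalarTower A (PowerSeries A) L] [AddCommGroup P] [Module A P] [Module.Projective A P]
    [Module.Finite (PowerSeries A) L]
    (htf : ∀ x : L, (X : PowerSeries A) • x = 0 → x = 0)
    (π : L →ₗ[A] P) (hπ : Function.Surjective π)
    (h1 : ∀ x, π ((X : PowerSeries A) • x) = 0)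
    (h2 : ∀ x, π x = 0 → ∃ y, x = (X : PowerSeries A) • y) :
    Module.Projective (PowerSeries A) L := by
  obtain ⟨s, hs⟩ := Module.projective_lifting_property π LinearMap.id hπ
  have hs' : ∀ p, π (s p) = p := fun p => congrArg (fun f => f p) hs
  let f : PowerSeries A ⊗[A] P →ₗ[PowerSeries A] L := LinearMap.liftBaseChange _ s
  have hf : ∀ r p, f (r ⊗ₜ p) = r • s p := fun r p => LinearMap.liftBaseChange_tmul _ s r p
  have hdec : ∀ x : PowerSeries A ⊗[A] P, ∃ p y, x = 1 ⊗ₜ p + (X : PowerSeries A) • y := by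
    intro x
    induction x with
    | zero => exact ⟨0, 0, by simp⟩
    | add x y hx hy =>
      obtain ⟨p, a, rfl⟩ := hx
      obtain ⟨q, b, rfl⟩ := hy
      exact ⟨p + q, a + b, by rw [TensorProduct.tmul_add, smul_add]; abel⟩
    | tmul r p =>
      obtain ⟨r', hr'⟩ := smul_decomp (L := PowerSeries A ⊗[A] P) r
      refine ⟨constantCoeff r • p, r' • 1 ⊗ₜ p, ?_⟩
      have := hr' (1 ⊗ₜ p)
      rw [TensorProduct.tmul_smul, ← this, TensorProduct.smul_tmul', smul_eq_mul, mul_one]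
  have hstep : ∀ x, f x = 0 → ∃ y, f y = 0 ∧ x = (X : PowerSeries A) • y := by
    intro x hx
    obtain ⟨p, y, rfl⟩ := hdec x
    rw [map_add, hf, one_smul, map_smul] at hx
    have hp : p = 0 := by
      have := congrArg π hx
      rwa [map_add, h1, hs', add_zero, map_zero] at this
    subst hp
    refine ⟨y, htf _ (by simpa using hx), by simp⟩
  have hinj : Function.Injective f := by
    rw [injective_iff_map_eq_zero]
    intro x hx
    apply sep (A := A) x
    suffices ∀ n : ℕ, ∃ y, f y = 0 ∧ x = (X : PowerSeries A) ^ n • y from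
      fun n => (this n).imp fun _ h => h.2
    intro n
    induction n with
    | zero => exact ⟨x, hx, by simp⟩
    | succ n ih =>
      obtain ⟨y, hy, e⟩ := ih
      obtain ⟨z, hz, rfl⟩ := hstep y hy
      exact ⟨z, hz, by rw [e, smul_smul, pow_succ]⟩
  have hsurj : Function.Surjective f := by
    rw [← LinearMap.range_eq_top, eq_top_iff]
    refine Submodule.le_of_le_smul_of_le_jacobson_bot (Module.finite_def.1 inferInstance)
      (X_mem_jac (A := A)) ?_
    intro x _
    obtain ⟨y, hy⟩ := h2 (x - s (π x)) (by rw [map_sub, hs', sub_self])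
    rw [← sub_add_cancel x (s (π x)), add_comm, hy]
    refine Submodule.add_mem_sup ⟨1 ⊗ₜ π x, by rw [hf, one_smul]⟩ ?_
    exact Submodule.smul_mem_smul (Ideal.mem_span_singleton_self _) trivial
  exact Module.Projective.of_equiv (LinearEquiv.ofBijective f ⟨hinj, hsurj⟩)

section M

variable {M : Type*} [AddCommGroup M] [Module (PowerSeries A) M] [Module (LaurentSeries A) M]
    [IsScalarTower (PowerSeries A) (LaurentSeries A) M]

theorem X_unit (x : Submonoid.powers (X : PowerSeries A)) :
    IsUnit (algebraMap (PowerSeries A) (Module.End (PowerSeries A) M) x) := by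
  obtain ⟨k, hk⟩ := (IsLocalization.map_units (LaurentSeries A) x).exists_right_inv
  rw [Module.End.isUnit_iff]
  constructor
  · rw [injective_iff_map_eq_zero]
    intro m hm
    rw [Module.algebraMap_end_apply, ← algebraMap_smul (LaurentSeries A)] at hm
    have := congrArg (fun m => k • m) hm
    simpa only [smul_smul, mul_comm k, hk, one_smul, smul_zero] using this
  · intro m
    refine ⟨k • m, ?_⟩
    rw [Module.algebraMap_end_apply, ← algebraMap_smul (LaurentSeries A), smul_smul, hk, one_smul]

theorem exists_pow_smul_mem (N : Submodule (PowerSeries A) M)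
    (h : Submodule.span (LaurentSeries A) (N : Set M) = ⊤) (m : M) :
    ∃ n : ℕ, (X : PowerSeries A) ^ n • m ∈ N := by
  have hm : m ∈ Submodule.span (LaurentSeries A) (N : Set M) := h ▸ trivial
  induction hm using Submodule.span_induction with
  | mem x hx => exact ⟨0, by simpa using hx⟩
  | zero => exact ⟨0, by simp⟩
  | add x y _ _ hx hy =>
    obtain ⟨a, ha⟩ := hx
    obtain ⟨b, hb⟩ := hy
    refine ⟨a + b, ?_⟩
    rw [smul_add]
    refine N.add_mem ?_ ?_
    · rw [add_comm, pow_add, mul_smul]; exact N.smul_mem _ ha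
    · rw [pow_add, mul_smul]; exact N.smul_mem _ hb
  | smul k x _ hx =>
    obtain ⟨a, ha⟩ := hx
    obtain ⟨⟨r, ⟨_, b, rfl⟩⟩, hr⟩ :=
      IsLocalization.surj (Submonoid.powers (X : PowerSeries A)) k
    refine ⟨b + a, ?_⟩
    have : (X : PowerSeries A) ^ (b + a) • k • x = r • (X : PowerSeries A) ^ a • x := by
      rw [← algebraMap_smul (LaurentSeries A) r, ← hr, mul_comm, mul_smul, algebraMap_smul,
        pow_add, mul_smul]
      congr 1
      rw [← algebraMap_smul (LaurentSeries A) (X ^ a) (k • x),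
        ← algebraMap_smul (LaurentSeries A) (X ^ a) x, smul_comm]
    rw [this]
    exact N.smul_mem _ ha

instance towerK : IsScalarTower A (PowerSeries A) (LaurentSeries A) := by
  refine ⟨fun a r k => ?_⟩
  rw [Algebra.smul_def (a • r) k, Algebra.smul_def r k, LaurentSeries.coe_algebraMap, PowerSeries.coe_smul,
    ← HahnSeries.C_mul_eq_smul, ← HahnSeries.C_mul_eq_smul, mul_assoc]

theorem isLoc (L : Submodule (PowerSeries A) M)
    (h : Submodule.span (LaurentSeries A) (L : Set M) = ⊤) :
    IsLocalizedModule (Submonoid.powers (X : PowerSeries A)) L.subtype := by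
  refine ⟨X_unit, fun y => ?_, fun {a b} hab => ⟨1, by simpa using hab⟩⟩
  obtain ⟨n, hn⟩ := exists_pow_smul_mem L h y
  exact ⟨⟨⟨_, hn⟩, ⟨_, n, rfl⟩⟩, rfl⟩

end M

theorem pp_finite (k : LaurentSeries A) :
    (Function.support fun n : ℕ => k.coeff (-(n : ℤ) - 1)).Finite := by
  refine (Set.finite_Iic (-k.order).toNat).subset fun n hn => ?_
  have := HahnSeries.order_le_of_coeff_ne_zero hn
  simp only [Set.mem_Iic]
  omega

/-- Principal part. -/
noncomputable def pp : LaurentSeries A →ₗ[A] (ℕ →₀ A) where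
  toFun k := Finsupp.ofSupportFinite _ (pp_finite k)
  map_add' k l := by ext n; simp [Finsupp.ofSupportFinite]; rfl
  map_smul' a k := by ext n; simp [Finsupp.ofSupportFinite]; rfl

theorem pp_apply (k : LaurentSeries A) (n : ℕ) : pp k n = k.coeff (-(n : ℤ) - 1) := rfl

theorem pp_surj : Function.Surjective (pp (A := A)) := by
  intro f
  induction f using Finsupp.induction_linear with
  | zero => exact ⟨0, map_zero _⟩
  | add f g hf hg =>
    obtain ⟨a, rfl⟩ := hf
    obtain ⟨b, rfl⟩ := hg
    exact ⟨a + b, map_add _ _ _⟩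
  | single n a =>
    refine ⟨HahnSeries.single (-(n : ℤ) - 1) a, ?_⟩
    ext m
    rw [pp_apply, HahnSeries.coeff_single, Finsupp.single_apply]
    congr 1
    simp [eq_comm]

theorem pp_eq_zero (k : LaurentSeries A) (h : pp k = 0) :
    ∃ r : PowerSeries A, algebraMap _ (LaurentSeries A) r = k := by
  refine ⟨PowerSeries.mk fun n => k.coeff n, ?_⟩
  ext i
  rw [LaurentSeries.coe_algebraMap, PowerSeries.coeff_coe]
  split_ifs with hi
  · have := DFunLike.congr_fun h ((-i - 1).toNat)
    rw [pp_apply] at this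
    rw [← show -(((-i - 1).toNat : ℕ) : ℤ) - 1 = i by omega, this]; rfl
  · rw [coeff_mk]; congr 1; omega

theorem pp_coe (r : PowerSeries A) : pp (algebraMap _ (LaurentSeries A) r) = 0 := by
  ext n
  rw [pp_apply, LaurentSeries.coe_algebraMap, PowerSeries.coeff_coe, if_pos (by omega)]; rfl

section M

variable {M : Type*} [AddCommGroup M] [Module A M]
    [Module (PowerSeries A) M] [Module (LaurentSeries A) M]
    [IsScalarTower A (PowerSeries A) M]
    [IsScalarTower (PowerSeries A) (LaurentSeries A) M]

theorem quot_proj (L : Submodule (PowerSeries A) M) [Module.Finite (PowerSeries A) L]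
    [Module.Projective (PowerSeries A) L]
    (h : Submodule.span (LaurentSeries A) (L : Set M) = ⊤) :
    Module.Projective A (M ⧸ L.restrictScalars A) := by
  have := isLoc L h
  obtain ⟨n, p, hp⟩ := Module.Finite.exists_fin' (PowerSeries A) L
  obtain ⟨i, hi⟩ := Module.projective_lifting_property p LinearMap.id hp
  let S := Submonoid.powers (X : PowerSeries A)
  let c : (Fin n → PowerSeries A) →ₗ[PowerSeries A] (Fin n → LaurentSeries A) :=
    LinearMap.compLeft (Algebra.linearMap _ _) _
  let I : M →ₗ[PowerSeries A] (Fin n → LaurentSeries A) :=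
    IsLocalizedModule.lift S L.subtype (c ∘ₗ i) X_unit
  have hI : ∀ x : L, I x = c (i x) := fun x => IsLocalizedModule.lift_apply S L.subtype _ _ x
  let Q : (Fin n → LaurentSeries A) →ₗ[PowerSeries A] M :=
    (Fintype.linearCombination (LaurentSeries A)
      (fun j => (p (Pi.single j 1) : M))).restrictScalars (PowerSeries A)
  have hQ : ∀ v, Q (c v) = p v := by
    suffices Q ∘ₗ c = L.subtype ∘ₗ p from fun v => congrArg (fun f => f v) this
    apply LinearMap.pi_ext'
    intro j
    ext
    simp only [Q, c, LinearMap.comp_apply, LinearMap.restrictScalars_apply,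
      Fintype.linearCombination_apply, LinearMap.compLeft_apply, Function.comp_apply,
      Algebra.linearMap_apply, algebraMap_smul, LinearMap.single_apply, Submodule.subtype_apply]
    rw [Finset.sum_eq_single j]
    · simp
    · intro b _ hb; simp [hb]
    · simp
  have hQI : Q ∘ₗ I = LinearMap.id := by
    apply IsLocalizedModule.ext S L.subtype X_unit
    ext x
    simp only [LinearMap.comp_apply, Submodule.subtype_apply, LinearMap.id_apply]
    rw [hI, hQ]
    exact congrArg Subtype.val (congrArg (fun f => f x) hi)
  obtain ⟨σ, hσ⟩ := Module.projective_lifting_property (pp (A := A)) LinearMap.id pp_surj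
  let C : (Fin n → LaurentSeries A) →ₗ[A] (Fin n → (ℕ →₀ A)) := LinearMap.compLeft pp _
  let Sg : (Fin n → (ℕ →₀ A)) →ₗ[A] (Fin n → LaurentSeries A) := LinearMap.compLeft σ _
  have hCs : ∀ v, C (Sg v) = v := fun v => by
    ext1 j
    exact congrArg (fun f => f (v j)) hσ
  have hC : ∀ v, C v = 0 → ∃ w, c w = v := by
    intro v hv
    have : ∀ j, ∃ r : PowerSeries A, algebraMap _ (LaurentSeries A) r = v j :=
      fun j => pp_eq_zero _ (congrFun hv j)
    choose w hw using this
    exact ⟨w, funext hw⟩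
  have hCc : ∀ w, C (c w) = 0 := fun w => funext fun j => pp_coe _
  refine Module.Projective.of_split (M := Fin n → (ℕ →₀ A))
    ((L.restrictScalars A).liftQ (C ∘ₗ I.restrictScalars A) ?_)
    ((L.restrictScalars A).mkQ ∘ₗ Q.restrictScalars A ∘ₗ Sg) ?_
  · intro x hx
    have := hI ⟨x, hx⟩
    simp only [LinearMap.mem_ker, LinearMap.comp_apply, LinearMap.restrictScalars_apply]
    rw [show I x = _ from this, hCc]
  · ext m
    simp only [LinearMap.comp_apply, Submodule.mkQ_apply, Submodule.liftQ_apply,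
      LinearMap.restrictScalars_apply, LinearMap.id_apply]
    rw [Submodule.Quotient.eq]
    obtain ⟨w, hw⟩ := hC (Sg (C (I m)) - I m) (by rw [map_sub, hCs, sub_self])
    have e : Q (I m) = m := congrArg (fun f => f m) hQI
    have : Q (Sg (C (I m))) - m = p w := by
      rw [← hQ, hw, map_sub, e]
    rw [this]
    exact (p w).2

theorem finite_of_torsion {B : Type*} [AddCommGroup B] [Module A B] [Module (PowerSeries A) B]
    [IsScalarTower A (PowerSeries A) B] [Module.Finite (PowerSeries A) B]
    (h : ∀ x : B, ∃ n : ℕ, (X : PowerSeries A) ^ n • x = 0) : Module.Finite A B := by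
  have key : ∀ (n : ℕ) (x : B), (X : PowerSeries A) ^ n • x = 0 →
      ((Submodule.span (PowerSeries A) {x}).restrictScalars A).FG := by
    intro n
    induction n with
    | zero =>
      intro x hx
      have : x = 0 := by simpa using hx
      subst this
      rw [Submodule.span_zero_singleton, Submodule.restrictScalars_bot]
      exact Submodule.fg_bot
    | succ n ih =>
      intro x hx
      have := ih ((X : PowerSeries A) • x) (by rwa [smul_smul, ← pow_succ])
      convert (Submodule.fg_span_singleton (R := A) x).sup this using 1
      apply le_antisymm
      · intro y hy
        obtain ⟨r, rfl⟩ := Submodule.mem_span_singleton.1 hy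
        obtain ⟨r', hr'⟩ := smul_decomp (L := B) r
        rw [hr', smul_comm X r' x]
        exact Submodule.add_mem_sup
          (Submodule.smul_mem _ _ (Submodule.mem_span_singleton_self x))
          (Submodule.smul_mem (Submodule.span (PowerSeries A) {(X : PowerSeries A) • x}) r'
            (Submodule.mem_span_singleton_self _))
      · refine sup_le ?_ ?_
        · rw [Submodule.span_singleton_le_iff_mem]
          exact Submodule.mem_span_singleton_self (R := PowerSeries A) x
        · intro y hy
          obtain ⟨r, rfl⟩ := Submodule.mem_span_singleton.1 hy
          exact Submodule.smul_mem (Submodule.span (PowerSeries A) {x}) r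
            (Submodule.smul_mem _ _ (Submodule.mem_span_singleton_self _))
  have all : ∀ N : Submodule (PowerSeries A) B, N.FG → (N.restrictScalars A).FG := by
    intro N hN
    induction N, hN using Submodule.fg_induction with
    | singleton x => obtain ⟨n, hn⟩ := h x; exact key n x hn
    | sup N₁ N₂ h₁ h₂ ih₁ ih₂ =>
      rw [Submodule.restrictScalars_sup]
      exact ih₁.sup ih₂
  rw [Module.finite_def]
  exact all ⊤ (Module.finite_def.1 inferInstance)

theorem quot_finite (L : Submodule (PowerSeries A) M) [Module.Finite (PowerSeries A) L]
    (U : Submodule A M) (hU : IsLatticeOpen A (U : Set M)) :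
    Module.Finite A (↥(L.restrictScalars A) ⧸ U.comap (L.restrictScalars A).subtype) := by
  obtain ⟨Λ, -, hs, hΛ⟩ := hU
  have h1 : Module.Finite A (L ⧸ Λ.comap L.subtype) := by
    refine finite_of_torsion fun x => ?_
    induction x using Submodule.Quotient.induction_on with
    | _ x =>
    obtain ⟨n, hn⟩ := exists_pow_smul_mem Λ hs (x : M)
    refine ⟨n, ?_⟩
    rw [← Submodule.Quotient.mk_smul, Submodule.Quotient.mk_eq_zero]
    exact hn
  have h2 := Module.Finite.equiv
    (Submodule.Quotient.restrictScalarsEquiv A (Λ.comap L.subtype)).symm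
  let e : L →ₗ[A] ↥(L.restrictScalars A) :=
    { toFun := fun x => ⟨x.1, x.2⟩, map_add' := fun _ _ => rfl, map_smul' := fun _ _ => rfl }
  refine Module.Finite.of_surjective (Submodule.liftQ ((Λ.comap L.subtype).restrictScalars A)
    ((U.comap (L.restrictScalars A).subtype).mkQ ∘ₗ e) ?_) ?_
  · intro x hx
    rw [LinearMap.mem_ker, LinearMap.comp_apply, Submodule.mkQ_apply,
      Submodule.Quotient.mk_eq_zero]
    exact hΛ hx
  · intro y
    obtain ⟨x, rfl⟩ := Submodule.mkQ_surjective _ y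
    exact ⟨Submodule.Quotient.mk ⟨x.1, x.2⟩, rfl⟩

theorem finite_of_quot (L Λ : Submodule (PowerSeries A) M) (hfg : Λ.FG) (hle : Λ ≤ L)
    (h : Module.Finite A
      (↥(L.restrictScalars A) ⧸ (Λ.restrictScalars A).comap (L.restrictScalars A).subtype)) :
    Module.Finite (PowerSeries A) L := by
  let e : ↥(L.restrictScalars A) →ₗ[A] L :=
    { toFun := fun x => ⟨x.1, x.2⟩, map_add' := fun _ _ => rfl, map_smul' := fun _ _ => rfl }
  have h1 : Module.Finite A (L ⧸ Λ.comap L.subtype) := by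
    refine Module.Finite.of_surjective (Submodule.liftQ _
      ((Λ.comap L.subtype).mkQ.restrictScalars A ∘ₗ e) ?_ :
      (↥(L.restrictScalars A) ⧸ (Λ.restrictScalars A).comap (L.restrictScalars A).subtype)
        →ₗ[A] _) ?_
    · intro x hx
      rw [LinearMap.mem_ker, LinearMap.comp_apply, LinearMap.restrictScalars_apply,
        Submodule.mkQ_apply, Submodule.Quotient.mk_eq_zero]
      exact hx
    · intro y
      obtain ⟨x, rfl⟩ := Submodule.mkQ_surjective _ y
      exact ⟨Submodule.Quotient.mk ⟨x.1, x.2⟩, rfl⟩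
  have h2 : Module.Finite (PowerSeries A) (L ⧸ Λ.comap L.subtype) :=
    Module.Finite.of_restrictScalars_finite A _ _
  have h3 : Module.Finite (PowerSeries A) Λ := Module.Finite.iff_fg.2 hfg
  have h4 : Module.Finite (PowerSeries A) (Λ.comap L.subtype) :=
    Module.Finite.equiv (Submodule.comapSubtypeEquivOfLe hle).symm
  exact Module.Finite.of_submodule_quotient (Λ.comap L.subtype)

theorem proj_of_quot (L : Submodule (PowerSeries A) M) [Module.Finite (PowerSeries A) L]
    [Module.Projective A (M ⧸ L.restrictScalars A)] : Module.Projective (PowerSeries A) L := by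
  have hD : Module.Projective A (M ⧸ L) :=
    Module.Projective.of_equiv (Submodule.Quotient.restrictScalarsEquiv A L)
  have hbij := (Module.End.isUnit_iff _).1
    (X_unit (M := M) ⟨(X : PowerSeries A), Submonoid.mem_powers _⟩)
  let E : M ≃ₗ[PowerSeries A] M := LinearEquiv.ofBijective _ hbij
  have hE : ∀ m, E m = (X : PowerSeries A) • m := fun m => rfl
  let φ : (M ⧸ L) →ₗ[A] (M ⧸ L) :=
    (algebraMap (PowerSeries A) (Module.End (PowerSeries A) (M ⧸ L)) X).restrictScalars A
  have hφ : ∀ d, φ d = (X : PowerSeries A) • d := fun d => rfl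
  have hφs : Function.Surjective φ := by
    intro d
    obtain ⟨m, rfl⟩ := Submodule.mkQ_surjective _ d
    refine ⟨L.mkQ (E.symm m), ?_⟩
    rw [hφ, ← map_smul, ← hE, E.apply_symm_apply]
  obtain ⟨t, ht⟩ := Module.projective_lifting_property φ LinearMap.id hφs
  have ht' : ∀ d, φ (t d) = d := fun d => congrArg (fun f => f d) ht
  have hker : Module.Projective A (LinearMap.ker φ) := by
    refine Module.Projective.of_split (LinearMap.ker φ).subtype
      (LinearMap.codRestrict (LinearMap.ker φ) (LinearMap.id - t ∘ₗ φ) ?_) ?_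
    · intro d
      simp [ht']
    · ext d
      simp [LinearMap.mem_ker.1 d.2]
  let π : L →ₗ[A] LinearMap.ker φ := LinearMap.codRestrict (LinearMap.ker φ)
    ((L.mkQ ∘ₗ E.symm.toLinearMap ∘ₗ L.subtype).restrictScalars A) (by
      intro x
      have : (X : PowerSeries A) • L.mkQ (E.symm x) = 0 := by
        rw [← map_smul, ← hE, E.apply_symm_apply, Submodule.mkQ_apply,
          Submodule.Quotient.mk_eq_zero]
        exact x.2
      exact this)
  have hπ : ∀ x : L, (π x : M ⧸ L) = L.mkQ (E.symm x) := fun x => rfl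
  refine proj_of_special ?_ π ?_ ?_ ?_
  · intro x hx
    apply Subtype.ext
    apply E.injective
    rw [hE, ← Submodule.coe_smul, hx]
    simp
  · rintro ⟨d, hd⟩
    obtain ⟨m, rfl⟩ := Submodule.mkQ_surjective _ d
    have hm : (X : PowerSeries A) • m ∈ L := by
      rw [LinearMap.mem_ker, hφ, ← map_smul, Submodule.mkQ_apply,
        Submodule.Quotient.mk_eq_zero] at hd
      exact hd
    refine ⟨⟨_, hm⟩, Subtype.ext ?_⟩
    rw [hπ]
    simp only [← hE, E.symm_apply_apply]
  · intro x
    apply Subtype.ext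
    rw [hπ, Submodule.coe_smul, ← hE, E.symm_apply_apply, Submodule.mkQ_apply,
      (Submodule.Quotient.mk_eq_zero _).2 x.2]
    rfl
  · intro x hx
    have := congrArg Subtype.val hx
    rw [hπ, Submodule.mkQ_apply, ZeroMemClass.coe_zero, Submodule.Quotient.mk_eq_zero] at this
    refine ⟨⟨_, this⟩, Subtype.ext ?_⟩
    rw [Submodule.coe_smul, ← hE, E.apply_symm_apply]

end M

end Stmt6Aux

/-- Let `M` be a finitely generated projective `A((u))`-module and `L` an
`A[[u]]`-submodule of `M`.  Then `L` is a finitely generated projective `A[[u]]`-module with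
`A((u))·L = M` iff `L` is open in `M` (for the natural topology), every quotient `L/U` of
`L` by an open `A`-submodule `U ⊆ L` is a finitely generated `A`-module (i.e. `L` is a
lattice), and `M/L` is a projective `A`-module (i.e. `L` is coprojective). -/
theorem stmt6 {A : Type*} [CommRing A] {M : Type*} [AddCommGroup M]
    [Module A M] [Module (PowerSeries A) M] [Module (LaurentSeries A) M]
    [IsScalarTower A (PowerSeries A) M]
    [IsScalarTower (PowerSeries A) (LaurentSeries A) M]
    [Module.Finite (LaurentSeries A) M] [Module.Projective (LaurentSeries A) M]
    (L : Submodule (PowerSeries A) M) :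
    (Module.Finite (PowerSeries A) L ∧ Module.Projective (PowerSeries A) L ∧
        Submodule.span (LaurentSeries A) (L : Set M) = ⊤) ↔
      (IsLatticeOpen A (L : Set M) ∧
        (∀ U : Submodule A M, U ≤ L.restrictScalars A → IsLatticeOpen A (U : Set M) →
          Module.Finite A
            (↥(L.restrictScalars A) ⧸ U.comap (L.restrictScalars A).subtype)) ∧
        Module.Projective A (M ⧸ L.restrictScalars A)) := by
  constructor
  · rintro ⟨hf, hp, hs⟩
    exact ⟨⟨L, Module.Finite.iff_fg.1 hf, hs, le_rfl⟩,
      fun U _ hU => Stmt6Aux.quot_finite L U hU, Stmt6Aux.quot_proj L hs⟩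
  · rintro ⟨⟨Λ, hfg, hs, hle⟩, hfin, hproj⟩
    have hf := Stmt6Aux.finite_of_quot L Λ hfg hle
      (hfin (Λ.restrictScalars A) hle ⟨Λ, hfg, hs, le_rfl⟩)
    refine ⟨hf, Stmt6Aux.proj_of_quot L, ?_⟩
    rw [eq_top_iff, ← hs]
    exact Submodule.span_mono hle
end

section
/- Let A be an Artinian local ring with residue field κ, let k be a finite field, set 𝔖_A = (W(k)⊗_{Z_p}A)[[u]], and let M be a finitely generated 𝔖_A[1/u]-module such that for some faithfully flat A-algebra A', the module M ⊗_{𝔖_A[1/u]} 𝔖_{A'}[1/u] is free of rank d over 𝔖_{A'}[1/u]. Then M is free of rank d over 𝔖_A[1/u]. -/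
open scoped TensorProduct

namespace Stmt12Aux

theorem finrank_aux {S S' M : Type} [CommRing S] [CommRing S'] [Algebra S S'] [AddCommGroup M]
    [Module S M] [Module.Finite S M] (d : ℕ)
    (e : (S' ⊗[S] M) ≃ₗ[S'] (Fin d → S')) (P : Ideal S) [P.IsMaximal]
    (hP : P.map (algebraMap S S') ≠ ⊤) :
    Module.finrank (S ⧸ P) ((S ⧸ P) ⊗[S] M) = d := by
  obtain ⟨Q, hQ, hPQ⟩ := Ideal.exists_le_maximal _ hP
  let _ : Field (S ⧸ P) := Ideal.Quotient.field P
  let _ : Field (S' ⧸ Q) := Ideal.Quotient.field Q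
  let _ : Algebra (S ⧸ P) (S' ⧸ Q) := (Ideal.quotientMap Q (algebraMap S S')
    (Ideal.map_le_iff_le_comap.1 hPQ)).toAlgebra
  have : IsScalarTower S (S ⧸ P) (S' ⧸ Q) := IsScalarTower.of_algebraMap_eq fun x => rfl
  have e1 := TensorProduct.AlgebraTensorModule.cancelBaseChange S (S ⧸ P) (S' ⧸ Q) (S' ⧸ Q) M
  have e2 := TensorProduct.AlgebraTensorModule.cancelBaseChange S S' (S' ⧸ Q) (S' ⧸ Q) M
  have e3 : ((S' ⧸ Q) ⊗[S'] (S' ⊗[S] M)) ≃ₗ[S' ⧸ Q] ((S' ⧸ Q) ⊗[S'] (Fin d → S')) :=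
    TensorProduct.AlgebraTensorModule.congr (LinearEquiv.refl _ _) e
  have h := (e1.trans (e2.symm.trans e3)).finrank_eq
  have : Nontrivial S' := (Ideal.Quotient.mk Q).domain_nontrivial
  rw [Module.finrank_baseChange (R := S' ⧸ Q) (S := S ⧸ P) (M' := (S ⧸ P) ⊗[S] M),
    Module.finrank_baseChange (R := S' ⧸ Q) (S := S')] at h
  simpa using h

theorem abstract_descent {S S' M : Type} [CommRing S] [CommRing S'] [Algebra S S']
    [AddCommGroup M] [Module S M] [Module.Finite S M] [Finite (MaximalSpectrum S)] (d : ℕ)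
    (hinj : Function.Injective (algebraMap S S'))
    (hP : ∀ P : Ideal S, P.IsMaximal → P.map (algebraMap S S') ≠ ⊤)
    (e : (S' ⊗[S] M) ≃ₗ[S'] (Fin d → S')) :
    Nonempty (M ≃ₗ[S] (Fin d → S)) := by
  classical
  have rk (P : MaximalSpectrum S) : Module.finrank (S ⧸ P.1) ((S ⧸ P.1) ⊗[S] M) = d :=
    haveI := P.2; finrank_aux d e P.1 (hP _ P.2)
  have hb : ∃ b : Fin d → M, ∀ P : MaximalSpectrum S,
      ∃ b' : Module.Basis (Fin d) (S ⧸ P.1) ((S ⧸ P.1) ⊗[S] M), ∀ i, b' i = 1 ⊗ₜ b i := by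
    let _ := @Ideal.Quotient.field
    have b' (P) := Module.finBasisOfFinrankEq _ _ (rk P)
    choose b hb using fun i ↦ Ideal.pi_tensorProductMk_quotient_surjective M _
      (fun _ _ ne ↦ Ideal.isCoprime_of_isMaximal (MaximalSpectrum.ext_iff.ne.mp ne)) (b' · i)
    exact ⟨b, fun P => ⟨b' P, fun i => (funext_iff.mp (hb i) P).symm⟩⟩
  obtain ⟨b, hb⟩ := hb
  have hspan : Submodule.span S (Set.range b) = ⊤ := by
    by_contra hne
    obtain ⟨N, hN, hle⟩ := (eq_top_or_exists_le_coatom (Submodule.span S (Set.range b))).resolve_left hne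
    obtain ⟨P, hPm, ⟨f⟩⟩ := isSimpleModule_iff_quot_maximal.1 (isSimpleModule_iff_isCoatom.2 hN)
    let g : M →ₗ[S] S ⧸ P := f.toLinearMap ∘ₗ N.mkQ
    have hg (i) : g (b i) = 0 := by
      have : N.mkQ (b i) = 0 := by
        simpa using hle (Submodule.subset_span ⟨i, rfl⟩)
      simp only [g, LinearMap.comp_apply, this, map_zero]
    obtain ⟨b', hb'⟩ := hb ⟨P, hPm⟩
    have h0 : (LinearMap.liftBaseChange (S ⧸ P) g) = 0 := by
      apply b'.ext
      intro i
      rw [hb']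
      simp [hg]
    apply hN.1
    rw [eq_top_iff]
    intro m _
    have h1 : g m = 0 := by simpa using congr($h0 (1 ⊗ₜ m))
    have h2 : N.mkQ m = 0 := f.injective (by simpa [g] using h1)
    simpa using h2
  let φ : (Fin d → S) →ₗ[S] M := Fintype.linearCombination S b
  have hφ : Function.Surjective φ := by
    rw [← LinearMap.range_eq_top, Fintype.range_linearCombination, hspan]
  let ψ : (Fin d → S') →ₗ[S'] (S' ⊗[S] M) := Fintype.linearCombination S' (fun i => 1 ⊗ₜ b i)
  have hcomm (x : Fin d → S) : ψ (fun i => algebraMap S S' (x i)) = 1 ⊗ₜ φ x := by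
    simp [ψ, φ, Fintype.linearCombination_apply, TensorProduct.tmul_sum]
  have hψ : Function.Surjective ψ := by
    rw [← LinearMap.range_eq_top, eq_top_iff]
    intro t _
    induction t with
    | zero => exact zero_mem _
    | add x y hx hy => exact add_mem (hx trivial) (hy trivial)
    | tmul s m =>
      obtain ⟨x, rfl⟩ := hφ m
      have : s ⊗ₜ[S] φ x = s • ((1 : S') ⊗ₜ[S] φ x) := by simp [TensorProduct.smul_tmul']
      rw [this, ← hcomm]
      exact Submodule.smul_mem _ _ ⟨_, rfl⟩
  have hψi : Function.Injective ψ := by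
    have : Function.Injective (e.toLinearMap ∘ₗ ψ) :=
      OrzechProperty.injective_of_surjective_endomorphism _ (e.surjective.comp hψ)
    exact Function.Injective.of_comp this
  have hφi : Function.Injective φ := by
    rw [← LinearMap.ker_eq_bot, LinearMap.ker_eq_bot']
    intro x hx
    have h1 : ψ (fun i => algebraMap S S' (x i)) = ψ 0 := by rw [hcomm, hx]; simp
    ext i
    apply hinj
    simpa using congr_fun (hψi h1) i
  exact ⟨(LinearEquiv.ofBijective φ ⟨hφi, hφ⟩).symm⟩

section
open PowerSeries

theorem mem_map_C_of_coeff_mem {R : Type} [CommRing R] {I : Ideal R} (hI : I.FG) (g : R⟦X⟧)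
    (hg : ∀ n, coeff n g ∈ I) : g ∈ I.map (C (R := R)) := by
  obtain ⟨s, rfl⟩ := hI
  have h (n : ℕ) := Submodule.mem_span_finset'.1 (hg n)
  choose c hc using h
  have : g = ∑ i : s, PowerSeries.mk (fun n => c n i) * C (i : R) := by
    ext n
    rw [← hc n]
    simp
  rw [this]
  exact Ideal.sum_mem _ fun i _ => Ideal.mul_mem_left _ _
    (Ideal.mem_map_of_mem _ (Ideal.subset_span i.2))

/-- The map `R[[u]] → (R/q)((u))`. -/
noncomputable def toLaurent {R : Type} [CommRing R] (q : Ideal R) :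
    R⟦X⟧ →+* LaurentSeries (R ⧸ q) :=
  (algebraMap (R ⧸ q)⟦X⟧ (LaurentSeries (R ⧸ q))).comp (PowerSeries.map (Ideal.Quotient.mk q))

theorem toLaurent_X {R : Type} [CommRing R] (q : Ideal R) : IsUnit (toLaurent q X) := by
  have := IsLocalization.map_units (LaurentSeries (R ⧸ q))
    (⟨X, Submonoid.mem_powers _⟩ : Submonoid.powers (X : (R ⧸ q)⟦X⟧))
  simpa [toLaurent] using this

theorem toLaurent_eq_zero {R : Type} [CommRing R] (q : Ideal R) (g : R⟦X⟧) :
    toLaurent q g = 0 ↔ ∀ n, coeff n g ∈ q := by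
  have : Function.Injective (algebraMap (R ⧸ q)⟦X⟧ (LaurentSeries (R ⧸ q))) :=
    HahnSeries.ofPowerSeries_injective
  rw [toLaurent, RingHom.comp_apply, map_eq_zero_iff _ this, PowerSeries.ext_iff]
  simp [Ideal.Quotient.eq_zero_iff_mem]

theorem lift_eq_zero {B L : Type} [CommRing B] [CommRing L] (x : B) (θ : B →+* L)
    (hx : IsUnit (θ x)) (s : Localization.Away x) (g : B) (n : ℕ)
    (h : s * algebraMap B _ x ^ n = algebraMap B _ g) :
    IsLocalization.Away.lift (S := Localization.Away x) x hx s = 0 ↔ θ g = 0 := by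
  have := congr(IsLocalization.Away.lift (S := Localization.Away x) x hx $h)
  simp only [map_mul, map_pow, IsLocalization.Away.lift_eq] at this
  rw [← this]
  exact ((hx.pow n).mul_left_eq_zero).symm

theorem lift_surj {R : Type} [CommRing R] (q : Ideal R) : Function.Surjective
    (IsLocalization.Away.lift (S := Localization.Away (X : R⟦X⟧)) X (toLaurent_X q)) := by
  intro y
  obtain ⟨⟨g, ⟨_, n, rfl⟩⟩, h⟩ :=
    IsLocalization.surj (Submonoid.powers (PowerSeries.X : (R ⧸ q)⟦X⟧)) y
  obtain ⟨g, rfl⟩ := PowerSeries.map_surjective _ (Ideal.Quotient.mk_surjective (I := q)) g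
  refine ⟨algebraMap _ _ g * IsLocalization.Away.invSelf (X : R⟦X⟧) ^ n, ?_⟩
  apply ((toLaurent_X q).pow n).mul_left_injective
  have h1 : algebraMap R⟦X⟧ (Localization.Away (X : R⟦X⟧)) X * IsLocalization.Away.invSelf X = 1 :=
    IsLocalization.Away.mul_invSelf _
  have h2 := congr(IsLocalization.Away.lift (S := Localization.Away (X : R⟦X⟧)) X (toLaurent_X q) $h1)
  simp only [map_mul, map_pow, IsLocalization.Away.lift_eq, map_one] at h2 ⊢
  rw [mul_assoc, ← mul_pow, mul_comm _ (toLaurent q X), h2, one_pow, mul_one]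
  simp [toLaurent] at h ⊢
  exact h.symm

theorem maximal_eq_ker {R : Type} [CommRing R] [IsArtinianRing R]
    (P : Ideal (Localization.Away (X : R⟦X⟧))) [P.IsMaximal] :
    RingHom.ker (IsLocalization.Away.lift (S := Localization.Away (X : R⟦X⟧)) X
      (toLaurent_X (P.comap ((algebraMap _ _).comp (C (R := R)))))) = P := by
  set q := (P.comap ((algebraMap _ _).comp (C (R := R)))) with hq
  have : q.IsPrime := by rw [hq]; infer_instance
  have : q.IsMaximal := inferInstance
  let _ : Field (R ⧸ q) := Ideal.Quotient.field q
  have hm := RingHom.ker_isMaximal_of_surjective _ (lift_surj q)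
  refine hm.eq_of_le (Ideal.IsPrime.ne_top inferInstance) ?_
  intro s hs
  obtain ⟨n, g, h⟩ := IsLocalization.Away.surj (X : R⟦X⟧) s
  rw [RingHom.mem_ker, lift_eq_zero _ _ _ s g n h, toLaurent_eq_zero] at hs
  have h1 := mem_map_C_of_coeff_mem (IsNoetherian.noetherian q) g hs
  have h2 : algebraMap _ (Localization.Away (X : R⟦X⟧)) g ∈ P := by
    have h3 := Ideal.mem_map_of_mem (algebraMap _ (Localization.Away (X : R⟦X⟧))) h1
    rw [Ideal.map_map] at h3
    exact Ideal.map_comap_le h3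
  rw [← h] at h2
  exact (Ideal.unit_mul_mem_iff_mem _ ((IsLocalization.Away.algebraMap_isUnit _).pow n)).1
    (by rwa [mul_comm] at h2)

theorem finite_max {R : Type} [CommRing R] [IsArtinianRing R] :
    Finite (MaximalSpectrum (Localization.Away (X : R⟦X⟧))) := by
  refine Finite.of_injective (β := PrimeSpectrum R)
    (fun P => ⟨P.asIdeal.comap ((algebraMap _ _).comp (C (R := R))),
      have := P.2; inferInstance⟩) ?_
  intro P Q h
  have := P.2
  have := Q.2
  have h' := congr(($h).asIdeal)
  dsimp only at h'
  ext1
  have key : ∀ q q' : Ideal R, q = q' →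
      RingHom.ker (IsLocalization.Away.lift (S := Localization.Away (X : R⟦X⟧)) X
        (toLaurent_X q)) =
      RingHom.ker (IsLocalization.Away.lift (S := Localization.Away (X : R⟦X⟧)) X
        (toLaurent_X q')) := by
    rintro _ _ rfl
    rfl
  exact (maximal_eq_ker P.1).symm.trans ((key _ _ h').trans (maximal_eq_ker Q.1))

theorem map_ne_top {R R' : Type} [CommRing R] [CommRing R'] [IsArtinianRing R] (f : R →+* R')
    (hf : ∀ q : Ideal R, q.IsPrime → q.map f ≠ ⊤)
    (P : Ideal (Localization.Away (X : R⟦X⟧))) (hP : P.IsMaximal) :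
    P.map (Localization.awayMap (PowerSeries.map f) X) ≠ ⊤ := by
  set q := (P.comap ((algebraMap _ _).comp (C (R := R)))) with hq
  have hqp : q.IsPrime := by rw [hq]; infer_instance
  have hX : IsUnit (toLaurent (q.map f) (PowerSeries.map f X)) := by
    rw [PowerSeries.map_X]; exact toLaurent_X _
  let θ := IsLocalization.Away.lift (S := Localization.Away (PowerSeries.map f X)) _ hX
  have : Nontrivial (R' ⧸ q.map f) := Ideal.Quotient.nontrivial_iff.2 (hf q hqp)
  refine ne_top_of_le_ne_top (RingHom.ker_ne_top θ) ?_
  rw [Ideal.map_le_iff_le_comap]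
  intro s hs
  rw [← maximal_eq_ker P] at hs
  obtain ⟨n, g, h⟩ := IsLocalization.Away.surj (X : R⟦X⟧) s
  rw [RingHom.mem_ker, lift_eq_zero _ _ _ s g n h, toLaurent_eq_zero] at hs
  have h' := congr(Localization.awayMap (PowerSeries.map f) X $h)
  simp only [map_mul, map_pow, Localization.awayMap, IsLocalization.Away.map, 
    IsLocalization.map_eq] at h'
  rw [Ideal.mem_comap, RingHom.mem_ker]
  refine (lift_eq_zero _ _ hX _ _ n h').2 ((toLaurent_eq_zero _ _).2 fun m => ?_)
  rw [PowerSeries.coeff_map]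
  exact Ideal.mem_map_of_mem _ (hs m)

theorem awayMap_inj {R R' : Type} [CommRing R] [CommRing R'] (f : R →+* R')
    (hf : Function.Injective f) :
    Function.Injective (Localization.awayMap (PowerSeries.map f) X) := by
  rw [injective_iff_map_eq_zero]
  intro s hs
  obtain ⟨n, g, h⟩ := IsLocalization.Away.surj (X : R⟦X⟧) s
  have h' := congr(Localization.awayMap (PowerSeries.map f) X $h)
  rw [map_mul, hs, zero_mul] at h'
  simp only [Localization.awayMap, IsLocalization.Away.map, IsLocalization.map_eq] at h'
  rw [eq_comm, IsLocalization.map_eq_zero_iff (Submonoid.powers (PowerSeries.map f X))] at h'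
  obtain ⟨⟨_, m, rfl⟩, h'⟩ := h'
  have hg : g = 0 := by
    apply PowerSeries.map_injective f hf
    ext j
    have := congr(coeff (j + m) $h')
    simpa [PowerSeries.coeff_X_pow_mul] using this
  rw [hg, map_zero] at h
  exact ((IsLocalization.Away.algebraMap_isUnit _).pow n).mul_left_eq_zero.1 h

end

theorem coeff_artinian (p : ℕ) [Fact p.Prime] (k : Type) [Field k] [Fintype k] [CharP k p]
    (A : Type) [CommRing A] [IsArtinianRing A] {a : ℕ} (hpa : (p : A) ^ a = 0) :
    IsArtinianRing (WittVector p k ⊗[ℤ] A) := by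
  let _ : Algebra A (WittVector p k ⊗[ℤ] A) := Algebra.TensorProduct.rightAlgebra
  have hfin : Finite (TruncatedWittVector p a k) := inferInstanceAs (Finite (Fin a → k))
  have : Module.Finite A (WittVector p k ⊗[ℤ] A) := by
    have hs := WittVector.truncate_surjective p a k
    choose σ hσ using hs
    refine ⟨Submodule.fg_def.2 ⟨Set.range (fun t => σ t ⊗ₜ[ℤ] (1 : A)), Set.finite_range _, ?_⟩⟩
    rw [eq_top_iff]
    intro x _
    induction x with
    | zero => exact zero_mem _
    | add x y hx hy => exact add_mem (hx trivial) (hy trivial)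
    | tmul w r =>
      have h1 : w - σ (WittVector.truncate a w) ∈ RingHom.ker (WittVector.truncate (p := p) a) := by
        rw [RingHom.mem_ker, map_sub, hσ, sub_self]
      rw [WittVector.mem_ker_truncate, ← WittVector.mem_span_p_pow_iff_le_coeff_eq_zero,
        Ideal.mem_span_singleton] at h1
      obtain ⟨z, hz⟩ := h1
      have h2 : w ⊗ₜ[ℤ] r = σ (WittVector.truncate a w) ⊗ₜ[ℤ] r := by
        rw [← sub_eq_zero, ← TensorProduct.sub_tmul, hz]
        have : (p : WittVector p k) ^ a * z = ((p : ℤ) ^ a) • z := by simp [zsmul_eq_mul]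
        rw [this, TensorProduct.smul_tmul]
        simp [zsmul_eq_mul, hpa]
      have h3 : w ⊗ₜ[ℤ] r = r • (σ (WittVector.truncate a w) ⊗ₜ[ℤ] (1 : A)) := by
        rw [h2, Algebra.smul_def]
        simp [Algebra.TensorProduct.right_algebraMap_apply]
      rw [h3]
      exact Submodule.smul_mem _ _ (Submodule.subset_span ⟨_, rfl⟩)
  exact IsArtinianRing.of_finite A _

theorem ff_left (A A' W : Type) [CommRing A] [CommRing A'] [CommRing W] [Algebra A A']
    [Module.FaithfullyFlat A A'] :
    (Algebra.TensorProduct.map (algebraMap A A').toIntAlgHom (AlgHom.id ℤ W)).toRingHom.FaithfullyFlat := by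
  let F := (Algebra.TensorProduct.map (algebraMap A A').toIntAlgHom (AlgHom.id ℤ W)).toRingHom
  let _ : Algebra (A ⊗[ℤ] W) (A' ⊗[ℤ] W) := F.toAlgebra
  have hF : algebraMap (A ⊗[ℤ] W) (A' ⊗[ℤ] W) = F := rfl
  have : IsScalarTower A (A ⊗[ℤ] W) (A' ⊗[ℤ] W) := by
    refine IsScalarTower.of_algebraMap_eq (R := A) (S := A ⊗[ℤ] W) (A := A' ⊗[ℤ] W) fun x => ?_
    rw [hF]; simp [F, Algebra.TensorProduct.algebraMap_apply]
  have : Algebra.IsPushout A A' (A ⊗[ℤ] W) (A' ⊗[ℤ] W) :=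
    Algebra.IsPushout.tensorProduct_tensorProduct ℤ W A A' (by
      ext x; rw [hF]; simp [F])
  exact RingHom.FaithfullyFlat.isStableUnderBaseChange A A' (A ⊗[ℤ] W) (A' ⊗[ℤ] W)
    (RingHom.faithfullyFlat_algebraMap_iff.2 inferInstance)

theorem ff_right (A A' W : Type) [CommRing A] [CommRing A'] [CommRing W] [Algebra A A']
    [Module.FaithfullyFlat A A'] :
    (Algebra.TensorProduct.map (AlgHom.id ℤ W) (algebraMap A A').toIntAlgHom).toRingHom.FaithfullyFlat := by
  have h1 := RingHom.FaithfullyFlat.stableUnderComposition _ _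
    (RingHom.FaithfullyFlat.of_bijective
      (f := (Algebra.TensorProduct.comm ℤ W A).toRingEquiv.toRingHom)
      (Algebra.TensorProduct.comm ℤ W A).bijective)
    (ff_left A A' W)
  have h2 := RingHom.FaithfullyFlat.stableUnderComposition _ _ h1
    (RingHom.FaithfullyFlat.of_bijective
      (f := (Algebra.TensorProduct.comm ℤ A' W).toRingEquiv.toRingHom)
      (Algebra.TensorProduct.comm ℤ A' W).bijective)
  convert h2
  apply RingHom.ext
  intro x
  induction x with
  | zero => simp
  | add x y hx hy => rw [map_add, map_add, hx, hy]
  | tmul w r => simp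

theorem ff_ne_top {R R' : Type} [CommRing R] [CommRing R'] {f : R →+* R'} (hf : f.FaithfullyFlat)
    (q : Ideal R) (hq : q.IsPrime) : q.map f ≠ ⊤ := by
  let _ := f.toAlgebra
  have : Module.FaithfullyFlat R R' := hf
  intro h
  have h2 := Ideal.comap_map_eq_self_of_faithfullyFlat (B := R') q
  rw [RingHom.algebraMap_toAlgebra, h, Ideal.comap_top] at h2
  exact hq.ne_top h2.symm

end Stmt12Aux

noncomputable section

namespace Stmt12

variable (p : ℕ) [Fact p.Prime] (k : Type) [Field k] [Fintype k] [CharP k p]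
variable (A : Type) [CommRing A]

/-- The coefficient ring `W(k) ⊗ A`. -/
abbrev Coeff : Type := WittVector p k ⊗[ℤ] A

/-- The ring `𝔖_A = (W(k) ⊗ A)[[u]]`. -/
abbrev SS : Type := PowerSeries (Coeff p k A)

/-- The ring `𝔖_A[1/u]`, realised as the localization of `𝔖_A` away from `u`. -/
abbrev SL : Type := Localization.Away (PowerSeries.X : SS p k A)

variable (A' : Type) [CommRing A'] [Algebra A A']

/-- The map `𝔖_A → 𝔖_{A'}` induced by `A → A'`. -/
def ssMap : SS p k A →+* SS p k A' :=
  PowerSeries.map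
    (Algebra.TensorProduct.map (AlgHom.id ℤ (WittVector p k))
      ((algebraMap A A').toIntAlgHom)).toRingHom

/-- The ring `𝔖_{A'}[1/u]`, realised as the localization of `𝔖_{A'}` away from the image
of `u`. -/
abbrev SL' : Type := Localization.Away ((ssMap p k A A') PowerSeries.X)

noncomputable instance : Algebra (SL p k A) (SL' p k A A') :=
  (Localization.awayMap (ssMap p k A A') PowerSeries.X).toAlgebra

set_option synthInstance.maxHeartbeats 1000000 in
set_option maxHeartbeats 1000000 in
/-- Let `A` be an Artinian local `ℤ/pᵃℤ`-algebra, `k` a finite field, and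
`M` a finitely generated `𝔖_A[1/u]`-module such that for some faithfully flat `A`-algebra
`A'` the base change `M ⊗_{𝔖_A[1/u]} 𝔖_{A'}[1/u]` is free of rank `d`.  Then `M` is free of
rank `d` over `𝔖_A[1/u]`. -/
theorem stmt12 [IsArtinianRing A] [IsLocalRing A] {a : ℕ} (ha : 1 ≤ a)
    (hpa : (p : A) ^ a = 0)
    [Module.FaithfullyFlat A A']
    (M : Type) [AddCommGroup M] [Module (SL p k A) M] [Module.Finite (SL p k A) M]
    (d : ℕ)
    (hfree : Nonempty
      ((TensorProduct (SL p k A) (SL' p k A A') M)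
        ≃ₗ[SL' p k A A'] (Fin d → SL' p k A A'))) :
    Nonempty (M ≃ₗ[SL p k A] (Fin d → SL p k A)) := by
  have hff := Stmt12Aux.ff_right A A' (WittVector p k)
  have hart : IsArtinianRing (Coeff p k A) := Stmt12Aux.coeff_artinian p k A hpa
  have hfin : Finite (MaximalSpectrum (SL p k A)) := Stmt12Aux.finite_max
  obtain ⟨e⟩ := hfree
  exact Stmt12Aux.abstract_descent d (Stmt12Aux.awayMap_inj _ hff.injective)
    (Stmt12Aux.map_ne_top _ (Stmt12Aux.ff_ne_top hff)) e

end Stmt12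
end
end

section
/- Let A be a Noetherian local ring with a closed point t ∈ Spec A corresponding to its maximal ideal, and suppose t lies in the closure of a nonempty constructible subset C of Spec A with t ∉ C. Then there exists a prime ideal P of A with the property that A/P is a one-dimensional Noetherian local domain whose generic point lies in C. -/
theorem stmt17_aux {B : Type*} [CommRing B] [IsNoetherianRing B] [IsLocalRing B] [IsDomain B]
    (f : B) (hf0 : f ≠ 0) (hfm : f ∈ IsLocalRing.maximalIdeal B)
    (hf : ∀ Q : Ideal B, Q.IsPrime → Q ≠ ⊥ → f ∈ Q) : ringKrullDim B = 1 := by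
  have key : IsLocalRing.maximalIdeal B ∈ (Ideal.span {f}).minimalPrimes := by
    by_contra hcon
    have hfin := (Ideal.span {f}).finite_minimalPrimes_of_isNoetherianRing B
    have hav : ¬ ((IsLocalRing.maximalIdeal B : Set B) ⊆
        ⋃ q ∈ (Ideal.span {f}).minimalPrimes, (q : Set B)) := by
      intro h
      rw [Ideal.subset_union_prime_finite hfin ⊥ ⊥ (fun q hq _ _ => hq.isPrime)] at h
      obtain ⟨q, hq, hle⟩ := h
      have : q = IsLocalRing.maximalIdeal B :=
        ((IsLocalRing.maximalIdeal.isMaximal B).eq_of_le hq.isPrime.ne_top hle).symm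
      exact hcon (this ▸ hq)
    obtain ⟨x, hxm, hx⟩ := Set.not_subset.mp hav
    simp only [Set.mem_iUnion, not_exists] at hx
    have hspan : Ideal.span {x} ≠ ⊤ := by
      rw [Ne, Ideal.span_singleton_eq_top]
      exact (IsLocalRing.mem_maximalIdeal x).mp hxm
    obtain ⟨Q, hQ⟩ := Ideal.nonempty_minimalPrimes hspan
    have hQp := hQ.isPrime
    have hxQ : x ∈ Q := hQ.le (Ideal.mem_span_singleton_self x)
    have hQ1 := Ideal.height_le_one_of_isPrincipal_of_mem_minimalPrimes _ Q hQ
    have hQ0 : Q ≠ ⊥ := by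
      rintro rfl
      have hx0 : x = 0 := by simpa using hxQ
      obtain ⟨q, hq, -⟩ := Ideal.exists_minimalPrimes_le
        ((Ideal.span_singleton_le_iff_mem _).mpr hfm)
      exact hx q hq (hx0 ▸ q.zero_mem)
    obtain ⟨q, hq, hqQ⟩ := Ideal.exists_minimalPrimes_le
        ((Ideal.span_singleton_le_iff_mem _).mpr (hf Q hQp hQ0))
    have hqp := hq.isPrime
    have hlt : q < Q := lt_of_le_of_ne hqQ (by rintro rfl; exact hx q hq hxQ)
    have h0 := Ideal.height_le_iff.mp hQ1 q hqp hlt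
    have h0' : q.height = 0 := by simpa using h0
    have hqb : q = ⊥ := by
      have := Ideal.height_eq_zero_iff.mp h0'
      rw [IsDomain.minimalPrimes_eq_singleton_bot] at this
      exact this
    have hfq : f ∈ q := hq.le (Ideal.mem_span_singleton_self f)
    exact hf0 (by simpa [hqb] using hfq)
  have h1 := Ideal.height_le_one_of_isPrincipal_of_mem_minimalPrimes _ _ key
  rw [← IsLocalRing.maximalIdeal_height_eq_ringKrullDim]
  have h2 : (IsLocalRing.maximalIdeal B).height ≠ 0 := by
    intro h
    have := Ideal.height_eq_zero_iff.mp h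
    rw [IsDomain.minimalPrimes_eq_singleton_bot] at this
    have h3 : IsLocalRing.maximalIdeal B = ⊥ := this
    exact hf0 (by simpa [h3] using hfm)
  have h3 : (IsLocalRing.maximalIdeal B).height = 1 :=
    le_antisymm h1 (Order.one_le_iff_ne_zero.mpr h2)
  rw [h3]; rfl

/-- If `A` is a Noetherian local ring whose closed point `t` lies in the
closure of a nonempty constructible subset `C` of `Spec A` with `t ∉ C`, then there is a prime
`P` of `A` (a point of `C`) such that `A/P` is a one-dimensional Noetherian local domain;
the generic point of `Spec (A/P)`, namely `P` itself, lies in `C`. -/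
theorem stmt17 {A : Type*} [CommRing A] [IsNoetherianRing A] [IsLocalRing A]
    (C : Set (PrimeSpectrum A)) (hne : C.Nonempty)
    (hcon : ∃ 𝒮 : Finset (Set (PrimeSpectrum A)),
      (∀ s ∈ 𝒮, IsLocallyClosed s) ∧ C = ⋃ s ∈ 𝒮, s)
    (hclos : IsLocalRing.closedPoint A ∈ closure C)
    (hnotin : IsLocalRing.closedPoint A ∉ C) :
    ∃ P : PrimeSpectrum A, P ∈ C ∧
      IsDomain (A ⧸ P.asIdeal) ∧ IsNoetherianRing (A ⧸ P.asIdeal) ∧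
      IsLocalRing (A ⧸ P.asIdeal) ∧ ringKrullDim (A ⧸ P.asIdeal) = 1 := by
  obtain ⟨S, hS, rfl⟩ := hcon
  rw [Finset.closure_biUnion] at hclos
  simp only [Set.mem_iUnion, not_exists] at hclos hnotin
  obtain ⟨s, hs, hts⟩ := hclos
  have hnot := hnotin s hs
  obtain ⟨U, Z, hU, hZ, rfl⟩ := hS s hs
  obtain ⟨P0, hP0U, hP0Z⟩ := closure_nonempty_iff.mp ⟨_, hts⟩
  have htZ : IsLocalRing.closedPoint A ∈ Z :=
    hZ.closure_subset_iff.mpr Set.inter_subset_right hts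
  have htU : IsLocalRing.closedPoint A ∉ U := fun h => hnot ⟨h, htZ⟩
  obtain ⟨_, ⟨f, rfl⟩, hfP0, hfU⟩ :=
    PrimeSpectrum.isTopologicalBasis_basic_opens.exists_subset_of_mem_open hP0U hU
  have hfm : f ∈ IsLocalRing.maximalIdeal A := by
    by_contra h
    exact htU (hfU h)
  obtain ⟨P, ⟨hPp, hP0P, hfP⟩, hmax⟩ := set_has_maximal_iff_noetherian.mpr
    (inferInstance : IsNoetherian A A)
    {P : Ideal A | P.IsPrime ∧ P0.asIdeal ≤ P ∧ f ∉ P} ⟨P0.asIdeal, P0.2, le_rfl, hfP0⟩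
  have hloc : IsLocalRing (A ⧸ P) :=
    IsLocalRing.of_surjective' (Ideal.Quotient.mk P) Ideal.Quotient.mk_surjective
  refine ⟨⟨P, hPp⟩, ?_, inferInstance, inferInstance, hloc, ?_⟩
  · simp only [Set.mem_iUnion]
    refine ⟨_, hs, hfU hfP, ?_⟩
    exact ((PrimeSpectrum.le_iff_specializes P0 ⟨P, hPp⟩).mp hP0P).mem_closed hZ hP0Z
  · have hf0 : Ideal.Quotient.mk P f ≠ 0 := by rwa [Ne, Ideal.Quotient.eq_zero_iff_mem]
    refine stmt17_aux (B := A ⧸ P) (Ideal.Quotient.mk P f) hf0 ?_ ?_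
    · rw [IsLocalRing.mem_maximalIdeal, mem_nonunits_iff]
      intro hu
      have : IsLocalHom (Ideal.Quotient.mk P) :=
        IsLocalHom.of_surjective _ Ideal.Quotient.mk_surjective
      exact (IsLocalRing.mem_maximalIdeal f).mp hfm (isUnit_of_map_unit (Ideal.Quotient.mk P) f hu)
    · intro Q hQ hQ0
      by_contra hfQ
      have hle : P ≤ Q.comap (Ideal.Quotient.mk P) := by
        intro x hx
        rw [Ideal.mem_comap, Ideal.Quotient.eq_zero_iff_mem.mpr hx]
        exact Q.zero_mem
      refine hmax (Q.comap (Ideal.Quotient.mk P)) ⟨hQ.comap _, hP0P.trans hle, hfQ⟩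
        (lt_of_le_of_ne hle ?_)
      intro h
      apply hQ0
      rw [← Ideal.map_comap_of_surjective _ Ideal.Quotient.mk_surjective Q, ← h,
        Ideal.map_quotient_self]
end
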